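/- arXiv:2505.18439 — 2 statements merged into one kernel-verified Lean document; each statement's English description precedes it below -/
import Mathlib

section
/- The function B(r) = G′(r)² + Λ(r)·G(r)² is monotone nonincreasing on (0,R). -/
namespace PPW

noncomputable def C0 (m p x y : ℝ) : ℝ :=
  ((m-p*x)*(m-p*x^2)*(2*x*y*(2*(-m+2*p*x-9*p*x^2)-(m-p*x)^2-2*p*y*(m-p*x)) + y*(2*(3*m-m*x+p*x^2-3*p*x^3)+y*(m-p*x)^2)) + 2*x*((m-p*x)*(m-p*x^2)+p*y*(m-p*x^2)+2*p*x*y*(m-p*x))*(2*(3*m-m*x+p*x^2-3*p*x^3)+y*(m-p*x)^2))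
noncomputable def C1 (m p x y : ℝ) : ℝ :=
  ((m-p*x)*(m-p*x^2)*(2*x*y*(-2*p^2*x+12*p*x)+2*y*((m+p*x)*(m-p*x)-6*(m-p*x^2)) - (2*(3*m-m*x+p*x^2-3*p*x^3)+y*(m-p*x)^2)) + 2*x*((m-p*x)*(m-p*x^2)+p*y*(m-p*x^2)+2*p*x*y*(m-p*x))*((m+p*x)*(m-p*x)-6*(m-p*x^2)))
noncomputable def C2 (m p x : ℝ) : ℝ :=
  (-2*(m-p*x)*(m-p*x^2)*((m+p*x)*(m-p*x)-6*(m-p*x^2)))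

set_option maxHeartbeats 1000000 in
lemma n0_nonneg (m p x y : ℝ) (hp : 1 ≤ p) (hm : 2 * p + 1 ≤ m) (hx : 0 ≤ x) (hy : 0 ≤ y)
    (hxy : y = 1 - x) : 0 ≤ C0 m p x y := by
  obtain ⟨q, rfl⟩ : ∃ q, p = 1 + q := ⟨p - 1, by ring⟩
  obtain ⟨j, rfl⟩ : ∃ j, m = 3 + 2 * q + j := ⟨m - 3 - 2 * q, by ring⟩
  have hq : 0 ≤ q := by linarith
  have hj : 0 ≤ j := by linarith
  have key : C0 (3 + 2 * q + j) (1 + q) x y =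
      x^0*y^7*(243 + 540*q^1 + 432*q^2 + 144*q^3 + 16*q^4 + 270*j^1 + 432*j^1*q^1 + 216*j^1*q^2 + 32*j^1*q^3 + 108*j^2 + 108*j^2*q^1 + 24*j^2*q^2 + 18*j^3 + 8*j^3*q^1 + 1*j^4) +
      x^1*y^6*(1458 + 3069*q^1 + 2238*q^2 + 620*q^3 + 40*q^4 + 1575*j^1 + 2337*j^1*q^1 + 1008*j^1*q^2 + 100*j^1*q^3 + 609*j^2 + 543*j^2*q^1 + 90*j^2*q^2 + 97*j^3 + 35*j^3*q^1 + 5*j^4) +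
      x^2*y^5*(4302 + 8913*q^1 + 6265*q^2 + 1568*q^3 + 52*q^4 + 4407*j^1 + 6289*j^1*q^1 + 2450*j^1*q^2 + 144*j^1*q^3 + 1594*j^2 + 1295*j^2*q^1 + 145*j^2*q^2 + 231*j^3 + 63*j^3*q^1 + 10*j^4) +
      x^3*y^4*(6840 + 13950*q^1 + 9563*q^2 + 2265*q^3 + 42*q^4 + 6930*j^1 + 9620*j^1*q^1 + 3511*j^1*q^2 + 121*j^1*q^3 + 2417*j^2 + 1825*j^2*q^1 + 128*j^2*q^2 + 319*j^3 + 59*j^3*q^1 + 10*j^4) +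
      x^4*y^3*(5856 + 11524*q^1 + 7576*q^2 + 1691*q^3 + 18*q^4 + 6212*j^1 + 8284*j^1*q^1 + 2837*j^1*q^2 + 55*j^1*q^3 + 2212*j^2 + 1553*j^2*q^1 + 61*j^2*q^2 + 279*j^3 + 29*j^3*q^1 + 5*j^4) +
      x^5*y^2*(2640 + 4848*q^1 + 2952*q^2 + 600*q^3 + 3*q^4 + 3104*j^1 + 3864*j^1*q^1 + 1212*j^1*q^2 + 10*j^1*q^3 + 1200*j^2 + 768*j^2*q^1 + 12*j^2*q^2 + 156*j^3 + 6*j^3*q^1 + 1*j^4) +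
      x^6*y^1*(608 + 1008*q^1 + 552*q^2 + 100*q^3 + 816*j^1 + 912*j^1*q^1 + 252*j^1*q^2 + 360*j^2 + 204*j^2*q^1 + 52*j^3) +
      x^7*y^0*(64 + 96*q^1 + 48*q^2 + 8*q^3 + 96*j^1 + 96*j^1*q^1 + 24*j^1*q^2 + 48*j^2 + 24*j^2*q^1 + 8*j^3) := by
    unfold C0
    subst hxy
    ring
  rw [key]
  positivity

set_option maxHeartbeats 1000000 in
lemma n1_nonneg (m p x y : ℝ) (hp : 1 ≤ p) (hm : 2 * p + 1 ≤ m) (hx : 0 ≤ x) (hy : 0 ≤ y)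
    (hxy : y = 1 - x) : 0 ≤ 2 * C0 m p x y * (3+x) + 3 * C1 m p x y := by
  obtain ⟨q, rfl⟩ : ∃ q, p = 1 + q := ⟨p - 1, by ring⟩
  obtain ⟨j, rfl⟩ : ∃ j, m = 3 + 2 * q + j := ⟨m - 3 - 2 * q, by ring⟩
  have hq : 0 ≤ q := by linarith
  have hj : 0 ≤ j := by linarith
  have key : 2 * C0 (3 + 2 * q + j) (1 + q) x y * (3+x) + 3 * C1 (3 + 2 * q + j) (1 + q) x y =
      x^0*y^8*(243 + 972*q^1 + 1296*q^2 + 720*q^3 + 144*q^4 + 486*j^1 + 1296*j^1*q^1 + 1080*j^1*q^2 + 288*j^1*q^3 + 324*j^2 + 540*j^2*q^1 + 216*j^2*q^2 + 90*j^3 + 72*j^3*q^1 + 9*j^4) +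
      x^1*y^7*(1782 + 6669*q^1 + 8478*q^2 + 4524*q^3 + 872*q^4 + 3375*j^1 + 8721*j^1*q^1 + 7056*j^1*q^2 + 1828*j^1*q^3 + 2241*j^2 + 3663*j^2*q^1 + 1434*j^2*q^2 + 633*j^3 + 499*j^3*q^1 + 65*j^4) +
      x^2*y^6*(9747 + 30177*q^1 + 33225*q^2 + 15616*q^3 + 2660*q^4 + 13509*j^1 + 31749*j^1*q^1 + 23562*j^1*q^2 + 5600*j^1*q^3 + 7602*j^2 + 11895*j^2*q^1 + 4425*j^2*q^2 + 2009*j^3 + 1555*j^3*q^1 + 205*j^4) +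
      x^3*y^5*(27864 + 77349*q^1 + 76817*q^2 + 32365*q^3 + 4850*q^4 + 32739*j^1 + 70463*j^1*q^1 + 47839*j^1*q^2 + 10293*j^1*q^3 + 15800*j^2 + 23374*j^2*q^1 + 8138*j^2*q^2 + 3774*j^3 + 2844*j^3*q^1 + 371*j^4) +
      x^4*y^4*(40950 + 106713*q^1 + 99391*q^2 + 38967*q^3 + 5334*q^4 + 46431*j^1 + 93481*j^1*q^1 + 59207*j^1*q^2 + 11747*j^1*q^3 + 20860*j^2 + 29072*j^2*q^1 + 9472*j^2*q^2 + 4586*j^3 + 3316*j^3*q^1 + 425*j^4) +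
      x^5*y^3*(32124 + 79640*q^1 + 70811*q^2 + 26563*q^3 + 3489*q^4 + 38200*j^1 + 72650*j^1*q^1 + 43645*j^1*q^2 + 8213*j^1*q^3 + 17315*j^2 + 22645*j^2*q^1 + 6950*j^2*q^2 + 3675*j^3 + 2497*j^3*q^1 + 319*j^4) +
      x^6*y^2*(13488 + 31632*q^1 + 26946*q^2 + 9855*q^3 + 1302*q^4 + 17896*j^1 + 31980*j^1*q^1 + 18345*j^1*q^2 + 3359*j^1*q^3 + 8730*j^2 + 10593*j^2*q^1 + 3075*j^2*q^2 + 1887*j^3 + 1173*j^3*q^1 + 155*j^4) +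
      x^7*y^1*(2992 + 6504*q^1 + 5256*q^2 + 1874*q^3 + 249*q^4 + 4536*j^1 + 7440*j^1*q^1 + 4026*j^1*q^2 + 720*j^1*q^3 + 2472*j^2 + 2718*j^2*q^1 + 738*j^2*q^2 + 566*j^3 + 312*j^3*q^1 + 45*j^4) +
      x^8*y^0*(320 + 624*q^1 + 456*q^2 + 148*q^3 + 18*q^4 + 528*j^1 + 768*j^1*q^1 + 372*j^1*q^2 + 60*j^1*q^3 + 312*j^2 + 300*j^2*q^1 + 72*j^2*q^2 + 76*j^3 + 36*j^3*q^1 + 6*j^4) := by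
    unfold C0 C1
    subst hxy
    ring
  rw [key]
  positivity

set_option maxHeartbeats 1000000 in
lemma n2_nonneg (m p x y : ℝ) (hp : 1 ≤ p) (hm : 2 * p + 1 ≤ m) (hx : 0 ≤ x) (hy : 0 ≤ y)
    (hxy : y = 1 - x) : 0 ≤ C0 m p x y * (3+x)^2 + 3 * C1 m p x y * (3+x) + 9 * C2 m p x := by
  obtain ⟨q, rfl⟩ : ∃ q, p = 1 + q := ⟨p - 1, by ring⟩
  obtain ⟨j, rfl⟩ : ∃ j, m = 3 + 2 * q + j := ⟨m - 3 - 2 * q, by ring⟩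
  have hq : 0 ≤ q := by linarith
  have hj : 0 ≤ j := by linarith
  have key : C0 (3 + 2 * q + j) (1 + q) x y * (3+x)^2 + 3 * C1 (3 + 2 * q + j) (1 + q) x y * (3+x) + 9 * C2 (3 + 2 * q + j) (1 + q) x =
      x^2*y^7*(6075 + 15660*q^1 + 14544*q^2 + 5712*q^3 + 784*q^4 + 5238*j^1 + 10224*j^1*q^1 + 6264*j^1*q^2 + 1184*j^1*q^3 + 1476*j^2 + 1980*j^2*q^1 + 600*j^2*q^2 + 138*j^3 + 104*j^3*q^1 + 1*j^4) +
      x^3*y^6*(34668 + 88029*q^1 + 80478*q^2 + 31052*q^3 + 4168*q^4 + 31203*j^1 + 59913*j^1*q^1 + 36144*j^1*q^2 + 6724*j^1*q^3 + 9297*j^2 + 12207*j^2*q^1 + 3642*j^2*q^2 + 949*j^3 + 683*j^3*q^1 + 11*j^4) +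
      x^4*y^5*(80748 + 201303*q^1 + 180829*q^2 + 68552*q^3 + 9028*q^4 + 76797*j^1 + 144463*j^1*q^1 + 85682*j^1*q^2 + 15720*j^1*q^3 + 24520*j^2 + 31313*j^2*q^1 + 9181*j^2*q^2 + 2769*j^3 + 1881*j^3*q^1 + 46*j^4) +
      x^5*y^4*(98496 + 239706*q^1 + 210941*q^2 + 78633*q^3 + 10242*q^4 + 100782*j^1 + 184472*j^1*q^1 + 107275*j^1*q^2 + 19465*j^1*q^3 + 35075*j^2 + 43141*j^2*q^1 + 12386*j^2*q^2 + 4447*j^3 + 2807*j^3*q^1 + 100*j^4) +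
      x^6*y^3*(67308 + 158206*q^1 + 135568*q^2 + 49721*q^3 + 6486*q^4 + 75962*j^1 + 133666*j^1*q^1 + 75755*j^1*q^2 + 13621*j^1*q^3 + 29422*j^2 + 34313*j^2*q^1 + 9571*j^2*q^2 + 4251*j^3 + 2441*j^3*q^1 + 125*j^4) +
      x^7*y^2*(25824 + 57420*q^1 + 47250*q^2 + 16968*q^3 + 2235*q^4 + 33044*j^1 + 54648*j^1*q^1 + 29724*j^1*q^2 + 5266*j^1*q^3 + 14550*j^2 + 15684*j^2*q^1 + 4170*j^2*q^2 + 2424*j^3 + 1230*j^3*q^1 + 91*j^4) +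
      x^8*y^1*(5408 + 10968*q^1 + 8376*q^2 + 2854*q^3 + 366*q^4 + 7896*j^1 + 11784*j^1*q^1 + 5898*j^1*q^2 + 990*j^1*q^3 + 3984*j^2 + 3810*j^2*q^1 + 918*j^2*q^2 + 766*j^3 + 330*j^3*q^1 + 36*j^4) +
      x^9*y^0*(544 + 960*q^1 + 624*q^2 + 176*q^3 + 18*q^4 + 864*j^1 + 1104*j^1*q^1 + 456*j^1*q^2 + 60*j^1*q^3 + 480*j^2 + 384*j^2*q^1 + 72*j^2*q^2 + 104*j^3 + 36*j^3*q^1 + 6*j^4) := by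
    unfold C0 C1 C2
    subst hxy
    ring
  rw [key]
  positivity

lemma cubic_nonneg (m p x y v : ℝ) (hp : 1 ≤ p) (hm : 2 * p + 1 ≤ m) (hx : 0 ≤ x) (hy : 0 ≤ y)
    (hxy : y = 1 - x) (hv : 0 ≤ v) (hv3 : v * (3 + x) ≤ 3) :
    0 ≤ C2 m p x * v ^ 2 + C1 m p x y * v + C0 m p x y := by
  have h0 := n0_nonneg m p x y hp hm hx hy hxy
  have h1 := n1_nonneg m p x y hp hm hx hy hxy
  have h2 := n2_nonneg m p x y hp hm hx hy hxy
  have h3 : 0 ≤ 3 - v * (3 + x) := by linarith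
  have h4 : 0 < 9 * (3 + x) ^ 2 := by positivity
  have key : 9 * (3 + x) ^ 2 * (C2 m p x * v ^ 2 + C1 m p x y * v + C0 m p x y) =
      C0 m p x y * ((3 + x) ^ 2 * (3 - v * (3 + x)) ^ 2) +
      (2 * C0 m p x y * (3+x) + 3 * C1 m p x y) * ((3 + x) ^ 2 * v * (3 - v * (3 + x))) +
      (C0 m p x y * (3+x)^2 + 3 * C1 m p x y * (3+x) + 9 * C2 m p x) * ((3 + x) ^ 2 * v ^ 2) := by
    ring
  have : 0 ≤ 9 * (3 + x) ^ 2 * (C2 m p x * v ^ 2 + C1 m p x y * v + C0 m p x y) := by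
    rw [key]; positivity
  exact nonneg_of_mul_nonneg_right this h4

lemma tanh_hd (r : ℝ) : HasDerivAt Real.tanh (1 - Real.tanh r ^ 2) r := by
  have hc : Real.cosh r ≠ 0 := (Real.cosh_pos r).ne'
  have h := (Real.hasDerivAt_sinh r).div (Real.hasDerivAt_cosh r) hc
  have he : Real.tanh = Real.sinh / Real.cosh := by
    funext s; simp [Real.tanh_eq_sinh_div_cosh]
  rw [he]
  refine h.congr_deriv ?_
  simp only [Pi.div_apply]
  field_simp

lemma tanh_pos' {r : ℝ} (hr : 0 < r) : 0 < Real.tanh r := by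
  rw [Real.tanh_eq_sinh_div_cosh]
  exact div_pos (Real.sinh_pos_iff.2 hr) (Real.cosh_pos r)

lemma tanh_sq_lt (r : ℝ) : Real.tanh r ^ 2 < 1 := by
  rw [Real.tanh_eq_sinh_div_cosh, div_pow, div_lt_one (by have := Real.cosh_pos r; positivity)]
  have := Real.cosh_sq r
  linarith

lemma mono_aux (f f' : ℝ → ℝ) (hf : ∀ r, 0 < r → HasDerivAt f (f' r) r)
    (hf' : ∀ r, 0 < r → 0 ≤ f' r) {a b : ℝ} (ha : 0 < a) (hab : a ≤ b) : f a ≤ f b := by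
  have := monotoneOn_of_hasDerivWithinAt_nonneg (convex_Ioi (0:ℝ)) (f := f) (f' := f')
    (fun x hx => (hf x hx).continuousAt.continuousWithinAt)
    (fun x hx => by
      rw [interior_Ioi] at hx ⊢
      exact (hf x hx).hasDerivWithinAt)
    (fun x hx => by
      rw [interior_Ioi] at hx
      exact hf' x hx)
  exact this ha (lt_of_lt_of_le ha hab) hab

lemma mvt_aux (f f' : ℝ → ℝ) {a b : ℝ} (hab : a < b)
    (hf : ∀ r ∈ Set.Icc a b, HasDerivAt f (f' r) r) :
    ∃ c ∈ Set.Ioo a b, f' c * (b - a) = f b - f a := by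
  obtain ⟨c, hc, h⟩ := exists_hasDerivAt_eq_slope f f' hab
    (fun x hx => (hf x hx).continuousAt.continuousWithinAt)
    (fun x hx => hf x ⟨hx.1.le, hx.2.le⟩)
  refine ⟨c, hc, ?_⟩
  rw [h]
  have : b - a ≠ 0 := by linarith
  field_simp

lemma mvt_pos (f f' : ℝ → ℝ) {a b : ℝ} (hab : a < b)
    (hf : ∀ r ∈ Set.Icc a b, HasDerivAt f (f' r) r) (h : f a < f b) :
    ∃ c ∈ Set.Ioo a b, 0 < f' c := by
  obtain ⟨c, hc, e⟩ := mvt_aux f f' hab hf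
  refine ⟨c, hc, ?_⟩
  by_contra hn
  push Not at hn
  nlinarith

lemma mvt_neg (f f' : ℝ → ℝ) {a b : ℝ} (hab : a < b)
    (hf : ∀ r ∈ Set.Icc a b, HasDerivAt f (f' r) r) (h : f b < f a) :
    ∃ c ∈ Set.Ioo a b, f' c < 0 := by
  obtain ⟨c, hc, e⟩ := mvt_aux f f' hab hf
  refine ⟨c, hc, ?_⟩
  by_contra hn
  push Not at hn
  nlinarith

lemma lim_pos (f f' : ℝ → ℝ) {b : ℝ} (hb : 0 < b)
    (hf : ∀ r ∈ Set.Ioc 0 b, HasDerivAt f (f' r) r)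
    (hl : Filter.Tendsto f (nhdsWithin 0 (Set.Ioi 0)) (nhds 0)) (h : 0 < f b) :
    ∃ c ∈ Set.Ioo 0 b, 0 < f' c := by
  have h1 := hl.eventually (gt_mem_nhds h)
  have h2 : ∀ᶠ r in nhdsWithin (0:ℝ) (Set.Ioi 0), r ∈ Set.Ioo 0 b := Ioo_mem_nhdsGT hb
  obtain ⟨a, ha1, ha2⟩ := (h1.and h2).exists
  obtain ⟨c, hc, e⟩ := mvt_pos f f' ha2.2
    (fun r hr => hf r ⟨lt_of_lt_of_le ha2.1 hr.1, hr.2⟩) ha1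
  exact ⟨c, ⟨ha2.1.trans hc.1, hc.2⟩, e⟩

lemma lim_neg (f f' : ℝ → ℝ) {b : ℝ} (hb : 0 < b)
    (hf : ∀ r ∈ Set.Ioc 0 b, HasDerivAt f (f' r) r)
    (hl : Filter.Tendsto f (nhdsWithin 0 (Set.Ioi 0)) (nhds 0)) (h : f b < 0) :
    ∃ c ∈ Set.Ioo 0 b, f' c < 0 := by
  obtain ⟨c, hc, e⟩ := lim_pos (fun r => - f r) (fun r => - f' r) hb
    (fun r hr => (hf r hr).neg) (by simpa using hl.neg) (by linarith)
  exact ⟨c, hc, by linarith⟩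

/-- r ≥ t + t^3/3 -/
lemma tanh_bound {r : ℝ} (hr : 0 < r) : Real.tanh r * (3 + Real.tanh r ^ 2) ≤ 3 * r := by
  by_contra hn
  push Not at hn
  have hd : ∀ s, HasDerivAt (fun s => 3 * s - Real.tanh s * (3 + Real.tanh s ^ 2))
      (3 * (Real.tanh s ^ 2) ^ 2) s := by
    intro s
    have h := ((hasDerivAt_id s).const_mul 3).sub
      ((tanh_hd s).mul (((tanh_hd s).pow 2).const_add 3))
    exact h.congr_deriv (by simp; ring)
  obtain ⟨c, hc, e⟩ := mvt_neg _ _ hr (fun s _ => hd s) (by simp; linarith)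
  have : 0 ≤ 3 * (Real.tanh c ^ 2) ^ 2 := by positivity
  linarith

noncomputable def vv (b r : ℝ) : ℝ := Real.tanh r / (r + b)

noncomputable def F0 (m p x v : ℝ) : ℝ :=
  (v ^ 2 * ((m+p*x)*(m-p*x)-6*(m-p*x^2)) + v * (2*(3*m-m*x+p*x^2-3*p*x^3)+(1-x)*(m-p*x)^2)) /
    ((1-x)*((m-p*x)*(m-p*x^2)))

noncomputable def F1 (m p x v : ℝ) : ℝ := x / ((1-x)*(m-p*x)) - v * x / ((1-x)*(m-p*x^2))

noncomputable def F2 (m p x v : ℝ) : ℝ := v * x^2 / ((1-x)^2*((m-p*x)*(m-p*x^2)))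

lemma xx_hd (r : ℝ) : HasDerivAt (fun r => Real.tanh r ^ 2)
    (2 * Real.tanh r * (1 - Real.tanh r ^ 2)) r := by
  have h := (tanh_hd r).pow 2
  exact h.congr_deriv (by simp)

lemma vv_hd (b r : ℝ) (hr : r + b ≠ 0) : HasDerivAt (vv b)
    ((1 - Real.tanh r ^ 2) / (r + b) - Real.tanh r / (r+b)^2) r := by
  have h := (tanh_hd r).div ((hasDerivAt_id r).add_const b) hr
  have e : vv b = (Real.tanh / fun x => id x + b) := by funext s; simp [vv]
  rw [e]
  refine h.congr_deriv ?_
  simp only [id]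
  field_simp

lemma key_ineq {m p x v : ℝ} (hp : 1 ≤ p) (hx0 : 0 ≤ x) (hx1 : x ≤ 1) (hv0 : 0 ≤ v)
    (hv1 : v ≤ 1) (ha : 0 < m - p * x) :
    0 ≤ 2*(m-p*x^2)^3 - v*(m-p*x)^2*((m-p*x^2)*(3-x-v)+4*p*x^2*(1-x)) := by
  have hy : 0 ≤ 1 - x := by linarith
  have hw : 0 ≤ 1 - v := by linarith
  have hu : 0 ≤ 2 - x - v := by linarith
  obtain ⟨a, rfl⟩ : ∃ a, m = a + p * x := ⟨m - p * x, by ring⟩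
  have ha : 0 < a := by linarith
  have e : 2*((a+p*x)-p*x^2)^3 - v*((a+p*x)-p*x)^2*(((a+p*x)-p*x^2)*(3-x-v)+4*p*x^2*(1-x)) =
    a^2 * (a + p*x*(1-x)) * ((1-v)*(2-x-v)) + (1-v) * (a^2 * (4*p*x^2*(1-x)))
     + a^2 * (a + p*x*(1-x)) * x
     + 2*(p*x*(1-x))*(3*a*(p*x*(1-x)) + (p*x*(1-x))^2) + 4*(p*x*(1-x))*a^2*(1-x) := by ring
  rw [e]
  positivity

section
variable {m p : ℝ} {X V : ℝ → ℝ} {r t x' v' : ℝ}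

lemma F0_mono (hp : 1 ≤ p) (hm : 2 * p + 1 ≤ m) (hX : HasDerivAt X x' r) (hV : HasDerivAt V v' r)
    (ht : 0 < t) (hx' : t * x' = 2 * X r * (1 - X r)) (hv' : t * v' = V r * (1 - X r - V r))
    (hx0 : 0 < X r) (hx1 : X r < 1) (hv0 : 0 < V r) (hv3 : V r * (3 + X r) ≤ 3) :
    ∃ f', HasDerivAt (fun s => F0 m p (X s) (V s)) f' r ∧ 0 ≤ f' := by
  have ha : 0 < m - p * X r := by nlinarith
  have hd : 0 < m - p * X r ^ 2 := by nlinarith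
  have hy : 0 < 1 - X r := by linarith
  have ha' := ha.ne'
  have hd' := hd.ne'
  have hy' := hy.ne'
  have ht' := ht.ne'
  have hX2 : HasDerivAt (fun s => X s ^ 2) (2 * X r * x') r := (hX.pow 2).congr_deriv (by simp)
  have hX3 : HasDerivAt (fun s => X s ^ 3) (3 * X r ^ 2 * x') r := (hX.pow 3).congr_deriv (by simp)
  have hV2 : HasDerivAt (fun s => V s ^ 2) (2 * V r * v') r := (hV.pow 2).congr_deriv (by simp)
  have da : HasDerivAt (fun s => m - p * X s) (-(p * x')) r := (hX.const_mul p).const_sub m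
  have dd : HasDerivAt (fun s => m - p * X s ^ 2) (-(p * (2 * X r * x'))) r :=
    (hX2.const_mul p).const_sub m
  have dy : HasDerivAt (fun s => 1 - X s) (-x') r := hX.const_sub 1
  have da2 : HasDerivAt (fun s => (m - p * X s) ^ 2) (2 * (m - p * X r) * (-(p * x'))) r := 
    (da.pow 2).congr_deriv (by simp)
  have dp2 : HasDerivAt (fun s => (m+p*X s)*(m-p*X s)-6*(m-p*X s^2))
      ((p*x')*(m-p*X r) + (m+p*X r)*(-(p*x')) - 6*(-(p*(2*X r*x')))) r :=
    (((hX.const_mul p).const_add m).mul da).sub (dd.const_mul 6)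
  have dp1 : HasDerivAt (fun s => 2*(3*m-m*X s+p*X s^2-3*p*X s^3)+(1-X s)*(m-p*X s)^2)
      (2*(-(m*x')+p*(2*X r*x')-3*p*(3*X r^2*x')) + ((-x')*(m-p*X r)^2
        + (1-X r)*(2 * (m - p * X r) * (-(p * x'))))) r :=
    (((((hX.const_mul m).const_sub (3*m)).add (hX2.const_mul p)).sub
      (hX3.const_mul (3*p))).const_mul 2).add (dy.mul da2)
  have dnum := (hV2.mul dp2).add (hV.mul dp1)
  have dden := dy.mul (da.mul dd)
  have hden : (1 - X r) * ((m - p * X r) * (m - p * X r ^ 2)) ≠ 0 := by positivity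
  have dF := dnum.div dden hden
  refine ⟨_, dF, ?_⟩
  simp only [Pi.mul_apply, Pi.add_apply]
  apply div_nonneg _ (by positivity)
  have hc := cubic_nonneg m p (X r) (1 - X r) (V r) hp hm hx0.le hy.le rfl hv0.le hv3
  generalize X r = x at *
  generalize V r = v at *
  have h0 : 0 ≤ (1 - x) * v * (C2 m p x * v ^ 2 + C1 m p x (1-x) * v + C0 m p x (1-x)) := by
    positivity
  refine nonneg_of_mul_nonneg_right ?_ ht
  have hx'' : x' = 2 * x * (1 - x) / t := by field_simp; linarith
  have hv'' : v' = v * (1 - x - v) / t := by field_simp; linarith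
  refine le_of_le_of_eq h0 ?_
  unfold C0 C1 C2
  subst hx'' hv''
  field_simp
  ring

lemma F1_mono (hp : 1 ≤ p) (hm : 2 * p + 1 ≤ m) (hX : HasDerivAt X x' r) (hV : HasDerivAt V v' r)
    (ht : 0 < t) (hx' : t * x' = 2 * X r * (1 - X r)) (hv' : t * v' = V r * (1 - X r - V r))
    (hx0 : 0 < X r) (hx1 : X r < 1) (hv0 : 0 < V r) (hv1 : V r ≤ 1) :
    ∃ f', HasDerivAt (fun s => F1 m p (X s) (V s)) f' r ∧ 0 ≤ f' := by
  have ha : 0 < m - p * X r := by nlinarith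
  have hd : 0 < m - p * X r ^ 2 := by nlinarith
  have hy : 0 < 1 - X r := by linarith
  have ha' := ha.ne'
  have hd' := hd.ne'
  have hy' := hy.ne'
  have ht' := ht.ne'
  have hX2 : HasDerivAt (fun s => X s ^ 2) (2 * X r * x') r := (hX.pow 2).congr_deriv (by simp)
  have da : HasDerivAt (fun s => m - p * X s) (-(p * x')) r := (hX.const_mul p).const_sub m
  have dd : HasDerivAt (fun s => m - p * X s ^ 2) (-(p * (2 * X r * x'))) r :=
    (hX2.const_mul p).const_sub m
  have dy : HasDerivAt (fun s => 1 - X s) (-x') r := hX.const_sub 1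
  have dF := (hX.div (dy.mul da) (by simp only [Pi.mul_apply]; positivity)).sub
    ((hV.mul hX).div (dy.mul dd) (by simp only [Pi.mul_apply]; positivity))
  refine ⟨_, dF, ?_⟩
  simp only [Pi.mul_apply]
  generalize X r = x at *
  generalize V r = v at *
  have hx'' : x' = 2 * x * (1 - x) / t := by field_simp; linarith
  have hv'' : v' = v * (1 - x - v) / t := by field_simp; linarith
  have key : 0 ≤ 2*(m-p*x^2)^3 - v*(m-p*x)^2*((m-p*x^2)*(3-x-v)+4*p*x^2*(1-x)) := by
    exact key_ineq hp hx0.le hx1.le hv0.le hv1 ha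
  have : 0 ≤ (2*(m-p*x^2)^3 - v*(m-p*x)^2*((m-p*x^2)*(3-x-v)+4*p*x^2*(1-x))) * x /
      (t * (1-x) * (m-p*x)^2 * (m-p*x^2)^2) := by positivity
  refine le_of_le_of_eq this ?_
  subst hx'' hv''
  field_simp
  ring

lemma F2_mono (hp : 1 ≤ p) (hm : 2 * p + 1 ≤ m) (hX : HasDerivAt X x' r) (hV : HasDerivAt V v' r)
    (ht : 0 < t) (hx' : t * x' = 2 * X r * (1 - X r)) (hv' : t * v' = V r * (1 - X r - V r))
    (hx0 : 0 < X r) (hx1 : X r < 1) (hv0 : 0 < V r) (hv1 : V r ≤ 1) :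
    ∃ f', HasDerivAt (fun s => F2 m p (X s) (V s)) f' r ∧ 0 ≤ f' := by
  have ha : 0 < m - p * X r := by nlinarith
  have hd : 0 < m - p * X r ^ 2 := by nlinarith
  have hy : 0 < 1 - X r := by linarith
  have ha' := ha.ne'
  have hd' := hd.ne'
  have hy' := hy.ne'
  have ht' := ht.ne'
  have hX2 : HasDerivAt (fun s => X s ^ 2) (2 * X r * x') r := (hX.pow 2).congr_deriv (by simp)
  have da : HasDerivAt (fun s => m - p * X s) (-(p * x')) r := (hX.const_mul p).const_sub m
  have dd : HasDerivAt (fun s => m - p * X s ^ 2) (-(p * (2 * X r * x'))) r :=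
    (hX2.const_mul p).const_sub m
  have dy : HasDerivAt (fun s => (1 - X s)^2) (2 * (1 - X r) * (-x')) r := 
    ((hX.const_sub 1).pow 2).congr_deriv (by simp)
  have dF := ((hV.mul hX2).div (dy.mul (da.mul dd)) (by simp only [Pi.mul_apply]; positivity))
  refine ⟨_, dF, ?_⟩
  simp only [Pi.mul_apply]
  generalize X r = x at *
  generalize V r = v at *
  have hx'' : x' = 2 * x * (1 - x) / t := by field_simp; linarith
  have hv'' : v' = v * (1 - x - v) / t := by field_simp; linarith
  have h5 : 0 ≤ 5 - x - v := by linarith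
  have : 0 ≤ v * x^2 * ((5-x-v)*((m-p*x)*(m-p*x^2)) + 2*x*(1-x)*(p*(m-p*x^2)+2*p*x*(m-p*x)))
      / (t * (1-x)^2 * (m-p*x)^2 * (m-p*x^2)^2) := by positivity
  refine le_of_le_of_eq this ?_
  subst hx'' hv''
  field_simp
  ring

end

noncomputable def TT (d m p b r : ℝ) : ℝ :=
  F0 m p (Real.tanh r ^ 2) (vv b r) / 2 + d * F1 m p (Real.tanh r ^ 2) (vv b r)
    + d ^ 2 / 2 * F2 m p (Real.tanh r ^ 2) (vv b r) - 1

lemma TT_mono {d m p b : ℝ} (hp : 1 ≤ p) (hm : 2 * p + 1 ≤ m) (hd : 0 ≤ d) (hb : 0 ≤ b)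
    {r s : ℝ} (hr : 0 < r) (hrs : r ≤ s) : TT d m p b r ≤ TT d m p b s := by
  have H : ∀ r, 0 < r → ∃ f', HasDerivAt (TT d m p b) f' r ∧ 0 ≤ f' := by
    intro r hr
    have ht := tanh_pos' hr
    have hx0 : 0 < Real.tanh r ^ 2 := by positivity
    have hx1 := tanh_sq_lt r
    have hs : 0 < r + b := by linarith
    have hs' := hs.ne'
    have hv0 : 0 < vv b r := div_pos ht hs
    have hv3 : vv b r * (3 + Real.tanh r ^ 2) ≤ 3 := by
      have := tanh_bound hr
      unfold vv
      rw [div_mul_eq_mul_div, div_le_iff₀ hs]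
      linarith
    have hv1 : vv b r ≤ 1 := by nlinarith
    have hX := xx_hd r
    have hV := vv_hd b r hs'
    have hx' : Real.tanh r * (2 * Real.tanh r * (1 - Real.tanh r ^ 2)) =
      2 * Real.tanh r ^ 2 * (1 - Real.tanh r ^ 2) := by ring
    have hv' : Real.tanh r * ((1 - Real.tanh r ^ 2) / (r + b) - Real.tanh r / (r+b)^2) =
        vv b r * (1 - Real.tanh r ^ 2 - vv b r) := by
      unfold vv; field_simp
    obtain ⟨a0, h0, n0⟩ := F0_mono hp hm hX hV ht hx' hv' hx0 hx1 hv0 hv3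
    obtain ⟨a1, h1, n1⟩ := F1_mono hp hm hX hV ht hx' hv' hx0 hx1 hv0 hv1
    obtain ⟨a2, h2, n2⟩ := F2_mono hp hm hX hV ht hx' hv' hx0 hx1 hv0 hv1
    refine ⟨_, (((h0.div_const 2).add (h1.const_mul d)).add (h2.const_mul (d^2/2))).sub_const 1, ?_⟩
    positivity
  choose! f' hf using H
  exact mono_aux _ f' (fun r hr => (hf r hr).1) (fun r hr => (hf r hr).2) hr hrs

lemma tanh_lim : Filter.Tendsto Real.tanh (nhdsWithin 0 (Set.Ioi 0)) (nhds 0) := by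
  have h := (tanh_hd 0).continuousAt.tendsto
  rw [Real.tanh_zero] at h
  exact h.mono_left nhdsWithin_le_nhds

lemma vv_lim : Filter.Tendsto (vv 0) (nhdsWithin 0 (Set.Ioi 0)) (nhds 1) := by
  have h := (tanh_hd 0).tendsto_slope_zero_right
  simp at h
  refine h.congr ?_
  intro s
  simp [vv]
  ring

lemma TT_nonneg {d m p : ℝ} (hp : 1 ≤ p) (hm : 2 * p + 1 ≤ m) (hd : 0 ≤ d)
    {r : ℝ} (hr : 0 < r) : 0 ≤ TT d m p 0 r := by
  have hm0 : m ≠ 0 := by linarith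
  have hx : Filter.Tendsto (fun s => Real.tanh s ^ 2) (nhdsWithin 0 (Set.Ioi 0)) (nhds 0) := by
    simpa using tanh_lim.pow 2
  have hxv := hx.prodMk_nhds vv_lim
  have hc : ContinuousAt (fun z : ℝ × ℝ => F0 m p z.1 z.2 / 2 + d * F1 m p z.1 z.2
    + d ^ 2 / 2 * F2 m p z.1 z.2 - 1) (0, 1) := by
    unfold F0 F1 F2
    refine ContinuousAt.sub (ContinuousAt.add (ContinuousAt.add ?_ ?_) ?_) continuousAt_const
    · refine ContinuousAt.div_const (ContinuousAt.div (by fun_prop) (by fun_prop) ?_) _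
      simpa using hm0
    · refine ContinuousAt.mul continuousAt_const (ContinuousAt.sub (ContinuousAt.div (by fun_prop) (by fun_prop) ?_) (ContinuousAt.div (by fun_prop) (by fun_prop) ?_))
      · simpa using hm0
      · simpa using hm0
    · refine ContinuousAt.mul continuousAt_const (ContinuousAt.div (by fun_prop) (by fun_prop) ?_)
      simpa using hm0
  have hT : Filter.Tendsto (TT d m p 0) (nhdsWithin 0 (Set.Ioi 0)) (nhds 0) := by
    have h := hc.tendsto.comp hxv
    have e : F0 m p 0 1 / 2 + d * F1 m p 0 1 + d ^ 2 / 2 * F2 m p 0 1 - 1 = 0 := by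
      unfold F0 F1 F2
      simp
      field_simp
      ring
    simp only [e] at h
    exact h
  refine le_of_tendsto hT ?_
  filter_upwards [Ioo_mem_nhdsGT hr] with s hs
  exact TT_mono hp hm hd le_rfl hs.1 hs.2.le

noncomputable def HH (m p r : ℝ) : ℝ := m / Real.tanh r + p * Real.tanh r
noncomputable def LL (m p r : ℝ) : ℝ := m / Real.tanh r ^ 2 - (m + p) + p * Real.tanh r ^ 2
noncomputable def L1 (m p r : ℝ) : ℝ :=
  -(2 * (1 - Real.tanh r ^ 2) * (m - p * Real.tanh r ^ 4) / Real.tanh r ^ 3)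
noncomputable def L2 (m p r : ℝ) : ℝ :=
  2 * (1 - Real.tanh r ^ 2) * (3 * m - m * Real.tanh r ^ 2 + p * Real.tanh r ^ 4
    - 3 * p * Real.tanh r ^ 6) / Real.tanh r ^ 4

lemma HH_hd (m p : ℝ) {r : ℝ} (hr : 0 < r) : HasDerivAt (HH m p) (-LL m p r) r := by
  have ht := (tanh_pos' hr).ne'
  have h := ((hasDerivAt_const r m).div (tanh_hd r) ht).add ((tanh_hd r).const_mul p)
  refine h.congr_deriv ?_
  unfold LL
  field_simp
  ring

lemma LL_hd (m p : ℝ) {r : ℝ} (hr : 0 < r) : HasDerivAt (LL m p) (L1 m p r) r := by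
  have ht := (tanh_pos' hr).ne'
  have h := (((hasDerivAt_const r m).div (xx_hd r) (pow_ne_zero 2 ht)).sub_const (m + p)).add
    ((xx_hd r).const_mul p)
  refine h.congr_deriv ?_
  unfold L1
  field_simp
  ring

lemma L1_hd (m p : ℝ) {r : ℝ} (hr : 0 < r) : HasDerivAt (L1 m p) (L2 m p r) r := by
  have ht := (tanh_pos' hr).ne'
  have h := (((((xx_hd r).const_sub 1).const_mul 2).mul
    ((((tanh_hd r).pow 4).const_mul p).const_sub m)).div ((tanh_hd r).pow 3)
    (pow_ne_zero 3 ht)).neg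
  refine h.congr_deriv ?_
  unfold L2
  simp
  field_simp
  ring

lemma LL_pos {m p r : ℝ} (hp : 1 ≤ p) (hm : 2 * p + 1 ≤ m) (hr : 0 < r) : 0 < LL m p r := by
  have ht := tanh_pos' hr
  have ht' := ht.ne'
  have hx := tanh_sq_lt r
  have h1 : 0 < 1 - Real.tanh r ^ 2 := by linarith
  have h2 : 0 < m - p * Real.tanh r ^ 2 := by nlinarith
  have : LL m p r = (1 - Real.tanh r ^ 2) * (m - p * Real.tanh r ^ 2) / Real.tanh r ^ 2 := by
    unfold LL; field_simp; ring
  rw [this]; positivity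

lemma L1_neg {m p r : ℝ} (hp : 1 ≤ p) (hm : 2 * p + 1 ≤ m) (hr : 0 < r) : L1 m p r < 0 := by
  have ht := tanh_pos' hr
  have hx := tanh_sq_lt r
  have h1 : 0 < 1 - Real.tanh r ^ 2 := by linarith
  have h3 : Real.tanh r ^ 4 < 1 := by nlinarith
  have h2 : 0 < m - p * Real.tanh r ^ 4 := by nlinarith
  unfold L1
  have : 0 < 2 * (1 - Real.tanh r ^ 2) * (m - p * Real.tanh r ^ 4) / Real.tanh r ^ 3 := by positivity
  linarith

lemma LL_L1 {m p r : ℝ} (hp : 1 ≤ p) (hm : 2 * p + 1 ≤ m) (hr : 0 < r) :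
    2 * LL m p r + r * L1 m p r ≤ 0 := by
  have ht := tanh_pos' hr
  have ht' := ht.ne'
  have hx := tanh_sq_lt r
  have h1 : 0 < 1 - Real.tanh r ^ 2 := by linarith
  have hl := L1_neg hp hm hr
  have hb : Real.tanh r ≤ r := by
    have := tanh_bound hr
    have : 0 < Real.tanh r ^ 3 := by positivity
    nlinarith
  have e : 2 * LL m p r + Real.tanh r * L1 m p r = -(2 * p * (1 - Real.tanh r ^ 2) ^ 2) := by
    unfold LL L1; field_simp; ring
  have : 0 ≤ 2 * p * (1 - Real.tanh r ^ 2) ^ 2 := by positivity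
  nlinarith

lemma LL_anti {m p : ℝ} (hp : 1 ≤ p) (hm : 2 * p + 1 ≤ m) {r s : ℝ} (hr : 0 < r) (hrs : r < s) :
    LL m p s < LL m p r := by
  obtain ⟨c, hc, e⟩ := mvt_aux (LL m p) (L1 m p) hrs
    (fun u hu => LL_hd m p (lt_of_lt_of_le hr hu.1))
  have := L1_neg hp hm (hr.trans hc.1)
  nlinarith

noncomputable def zz (m p l d b r : ℝ) : ℝ :=
  2 * l - HH m p r ^ 2 / 2 + 2 * LL m p r - d + L1 m p r * (r + b)
    + (LL m p r - d) ^ 2 * (r + b) ^ 2 / 2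

lemma zz_hd {m p l d b : ℝ} (hp : 1 ≤ p) (hm : 2 * p + 1 ≤ m) (hb : 0 ≤ b) {r : ℝ} (hr : 0 < r) :
    HasDerivAt (zz m p l d b) ((r+b)^2 * LL m p r * (-L1 m p r) * TT d m p b r) r := by
  have hs : HasDerivAt (fun r : ℝ => r + b) 1 r := (hasDerivAt_id r).add_const b
  have h := ((((((HH_hd m p hr).pow 2).div_const 2).const_sub (2*l)).add
    ((LL_hd m p hr).const_mul 2)).sub_const d).add ((L1_hd m p hr).mul hs) |>.add
    (((((LL_hd m p hr).sub_const d).pow 2).mul (hs.pow 2)).div_const 2)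
  refine h.congr_deriv ?_
  clear h
  have ht := tanh_pos' hr
  have ht' := ht.ne'
  have hx := tanh_sq_lt r
  have h1 : 1 - Real.tanh r ^ 2 ≠ 0 := by linarith
  have h2 : m - p * Real.tanh r ^ 2 ≠ 0 := by nlinarith
  have h4 : Real.tanh r ^ 4 < 1 := by nlinarith
  have h3 : m - p * Real.tanh r ^ 4 ≠ 0 := by nlinarith
  have hs' : r + b ≠ 0 := by linarith
  have e : LL m p r = (1 - Real.tanh r ^ 2) * (m - p * Real.tanh r ^ 2) / Real.tanh r ^ 2 := by
    unfold LL; field_simp; ring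
  simp only [Pi.pow_apply]
  rw [e]
  unfold HH L1 L2 TT F0 F1 F2 vv
  simp only [← pow_mul]
  norm_num
  generalize Real.tanh r = t at *
  generalize r + b = σ at *
  obtain ⟨A, hA⟩ : ∃ A, A = m - p * t ^ 2 := ⟨_, rfl⟩
  obtain ⟨D, hD⟩ : ∃ D, D = m - p * t ^ 4 := ⟨_, rfl⟩
  obtain ⟨Y, hY⟩ : ∃ Y, Y = 1 - t ^ 2 := ⟨_, rfl⟩
  simp only [← hA, ← hD, ← hY] at h1 h2 h3 ⊢
  field_simp
  rw [hA, hD, hY]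
  ring

lemma sign_aux {f : ℝ → ℝ} {f' x : ℝ} (h : HasDerivAt f f' x) (hf : f x = 0) (hp : 0 < f')
    {a b : ℝ} (ha : a < x) (hb : x < b) :
    (∃ y ∈ Set.Ioo a x, f y < 0) ∧ ∃ y ∈ Set.Ioo x b, 0 < f y := by
  have h1 := h.tendsto_slope.eventually (lt_mem_nhds hp)
  have hl := h1.filter_mono (nhdsWithin_mono x (fun y (hy : y ∈ Set.Iio x) => (Set.mem_Iio.1 hy).ne))
  have hr := h1.filter_mono (nhdsWithin_mono x (fun y (hy : y ∈ Set.Ioi x) => (Set.mem_Ioi.1 hy).ne'))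
  obtain ⟨y, hy1, hy2⟩ := (hl.and (Ioo_mem_nhdsLT ha)).exists
  obtain ⟨z, hz1, hz2⟩ := (hr.and (Ioo_mem_nhdsGT hb)).exists
  refine ⟨⟨y, hy2, ?_⟩, ⟨z, hz2, ?_⟩⟩
  · rw [slope_def_field, hf, sub_zero] at hy1
    have : y - x < 0 := by linarith [hy2.2]
    by_contra hn
    push Not at hn
    have := div_nonpos_of_nonneg_of_nonpos hn this.le
    linarith
  · rw [slope_def_field, hf, sub_zero] at hz1
    have : 0 < z - x := by linarith [hz2.1]
    exact (div_pos_iff_of_pos_right this).1 hz1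

structure Dat (m p l1 l2 R : ℝ) (g1 g1' g2 g2' w : ℝ → ℝ) : Prop where
  hp : 1 ≤ p
  hm : 2 * p + 1 ≤ m
  hR : 0 < R
  d1 : ∀ r, 0 < r → HasDerivAt g1 (g1' r) r
  d1' : ∀ r, 0 < r → HasDerivAt g1' (-(HH m p r * g1' r) - l1 * g1 r) r
  d2 : ∀ r, 0 < r → HasDerivAt g2 (g2' r) r
  d2' : ∀ r, 0 < r → HasDerivAt g2' (-(HH m p r * g2' r) - (l2 - LL m p r) * g2 r) r
  p1 : ∀ r, 0 < r → r < R → 0 < g1 r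
  p2 : ∀ r, 0 < r → r < R → 0 < g2 r
  e1 : g1 R = 0
  e2 : g2 R = 0
  t1 : Filter.Tendsto g1 (nhdsWithin 0 (Set.Ioi 0)) (nhds 1)
  t1' : Filter.Tendsto g1' (nhdsWithin 0 (Set.Ioi 0)) (nhds 0)
  t2 : Filter.Tendsto g2 (nhdsWithin 0 (Set.Ioi 0)) (nhds 0)
  t2' : Filter.Tendsto g2' (nhdsWithin 0 (Set.Ioi 0)) (nhds 1)
  dw : ∀ r, 0 < r → HasDerivAt w (HH m p r * w r) r
  pw : ∀ r, 0 < r → 0 < w r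
  tw : Filter.Tendsto (fun r => w r / Real.tanh r ^ 2) (nhdsWithin 0 (Set.Ioi 0)) (nhds 0)

section
variable {m p l1 l2 R : ℝ} {g1 g1' g2 g2' w : ℝ → ℝ}

lemma Dat.tw0 (D : Dat m p l1 l2 R g1 g1' g2 g2' w) :
    Filter.Tendsto w (nhdsWithin 0 (Set.Ioi 0)) (nhds 0) := by
  have h := D.tw.mul (tanh_lim.pow 2)
  simp only [zero_mul] at h
  refine h.congr' ?_
  filter_upwards [self_mem_nhdsWithin] with r hr
  have := (tanh_pos' hr).ne'
  field_simp

lemma id_lim : Filter.Tendsto (fun r : ℝ => r) (nhdsWithin 0 (Set.Ioi 0)) (nhds 0) :=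
  Filter.tendsto_id.mono_left nhdsWithin_le_nhds

lemma Dat.twH (D : Dat m p l1 l2 R g1 g1' g2 g2' w) :
    Filter.Tendsto (fun r => w r * HH m p r) (nhdsWithin 0 (Set.Ioi 0)) (nhds 0) := by
  have h := D.tw.mul ((tanh_lim.const_mul m).add ((tanh_lim.pow 3).const_mul p))
  simp only [zero_mul] at h
  refine h.congr' ?_
  filter_upwards [self_mem_nhdsWithin] with r hr
  have := (tanh_pos' hr).ne'
  unfold HH
  field_simp

lemma Dat.twL (D : Dat m p l1 l2 R g1 g1' g2 g2' w) :
    Filter.Tendsto (fun r => w r * LL m p r) (nhdsWithin 0 (Set.Ioi 0)) (nhds 0) := by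
  have h := D.tw.mul ((((tanh_lim.pow 2).const_mul (m+p)).const_sub m).add
    ((tanh_lim.pow 4).const_mul p))
  simp only [zero_mul] at h
  refine h.congr' ?_
  filter_upwards [self_mem_nhdsWithin] with r hr
  have := (tanh_pos' hr).ne'
  unfold LL
  field_simp

/-- Wronskian -/
lemma Dat.W_hd (D : Dat m p l1 l2 R g1 g1' g2 g2' w) {r : ℝ} (hr : 0 < r) :
    HasDerivAt (fun r => w r * (g2' r * g1 r - g2 r * g1' r))
      (w r * (g1 r * g2 r) * (LL m p r - (l2 - l1))) r := by
  have h := (D.dw r hr).mul (((D.d2' r hr).mul (D.d1 r hr)).sub ((D.d2 r hr).mul (D.d1' r hr)))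
  refine h.congr_deriv ?_
  simp
  ring

lemma Dat.W_lim (D : Dat m p l1 l2 R g1 g1' g2 g2' w) :
    Filter.Tendsto (fun r => w r * (g2' r * g1 r - g2 r * g1' r))
      (nhdsWithin 0 (Set.Ioi 0)) (nhds 0) := by
  simpa using D.tw0.mul ((D.t2'.mul D.t1).sub (D.t2.mul D.t1'))

lemma Dat.delta_pos (D : Dat m p l1 l2 R g1 g1' g2 g2' w) : 0 < l2 - l1 := by
  by_contra hn
  push Not at hn
  have hR := D.hR
  have hpos : ∀ r, 0 < r → r < R → 0 < w r * (g1 r * g2 r) * (LL m p r - (l2 - l1)) := by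
    intro r hr hrR
    have h1 := D.p1 r hr hrR
    have h2 := D.p2 r hr hrR
    have h3 := D.pw r hr
    have h4 := LL_pos D.hp D.hm hr
    have h5 : 0 < LL m p r - (l2 - l1) := by linarith
    positivity
  obtain ⟨c, hc, e⟩ := mvt_aux _ _ (show R/2 < R by linarith)
    (fun r hr => D.W_hd (r := r) (by linarith [hr.1]))
  have h1 := hpos c (by linarith [hc.1]) hc.2
  have h2 : w (R/2) * (g2' (R/2) * g1 (R/2) - g2 (R/2) * g1' (R/2)) < 0 := by
    simp only [D.e1, D.e2] at e
    have : 0 < R - R/2 := by linarith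
    have := mul_pos h1 this
    linarith
  obtain ⟨c', hc', e'⟩ := lim_neg _ _ (show 0 < R/2 by linarith)
    (fun r hr => D.W_hd (r := r) hr.1) D.W_lim h2
  have := hpos c' hc'.1 (by linarith [hc'.2])
  linarith

lemma Dat.W_pos (D : Dat m p l1 l2 R g1 g1' g2 g2' w) {r : ℝ} (hr : 0 < r) (hrR : r < R) :
    0 < g2' r * g1 r - g2 r * g1' r := by
  by_contra hn
  push Not at hn
  have hw : w r * (g2' r * g1 r - g2 r * g1' r) ≤ 0 :=
    mul_nonpos_of_nonneg_of_nonpos (D.pw r hr).le hn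
  obtain ⟨c, hc, e⟩ := mvt_aux _ _ hrR
    (fun s hs => D.W_hd (r := s) (by linarith [hs.1]))
  simp only [D.e1, D.e2] at e
  have hc0 : 0 < c := hr.trans hc.1
  have h1 : 0 ≤ LL m p c - (l2 - l1) := by
    have a1 := D.p1 c hc0 hc.2
    have a2 := D.p2 c hc0 hc.2
    have a3 := D.pw c hc0
    have a4 : 0 < w c * (g1 c * g2 c) * (R - c + (c - r)) := by
      have : 0 < R - c + (c - r) := by linarith
      positivity
    by_contra h
    push Not at h
    nlinarith
  have hpos : ∀ s, 0 < s → s ≤ r → 0 < w s * (g1 s * g2 s) * (LL m p s - (l2 - l1)) := by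
    intro s hs hsr
    have a1 := D.p1 s hs (by linarith)
    have a2 := D.p2 s hs (by linarith)
    have a3 := D.pw s hs
    have a4 := LL_anti D.hp D.hm hs (show s < c by linarith [hc.1])
    have a5 : 0 < LL m p s - (l2 - l1) := by linarith
    positivity
  obtain ⟨c2, hc2, e2⟩ := mvt_aux _ _ (show r/2 < r by linarith)
    (fun s hs => D.W_hd (r := s) (by linarith [hs.1]))
  have h2 := mul_pos (hpos c2 (by linarith [hc2.1]) hc2.2.le) (show 0 < r - r/2 by linarith)
  have h3 : w (r/2) * (g2' (r/2) * g1 (r/2) - g2 (r/2) * g1' (r/2)) < 0 := by linarith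
  obtain ⟨c', hc', e'⟩ := lim_neg _ _ (show 0 < r/2 by linarith)
    (fun s hs => D.W_hd (r := s) hs.1) D.W_lim h3
  have := hpos c' hc'.1 (by linarith [hc'.2])
  linarith

noncomputable def XX (g1 g1' g2 g2' w : ℝ → ℝ) (b r : ℝ) : ℝ :=
  w r * ((g2' r * g1 r - g2 r * g1' r) * (r + b) - g2 r * g1 r)

noncomputable def nn (m p d : ℝ) (g1 g1' : ℝ → ℝ) (b r : ℝ) : ℝ :=
  -2 * g1' r - HH m p r * g1 r + (LL m p r - d) * (r + b) * g1 r

noncomputable def EE (m p d b r : ℝ) : ℝ :=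
  Real.exp (-(HH m p r * (r + b) / 2) - d * (r + b) ^ 2 / 4)

lemma Dat.X_hd (D : Dat m p l1 l2 R g1 g1' g2 g2' w) (b : ℝ) {r : ℝ} (hr : 0 < r) :
    HasDerivAt (XX g1 g1' g2 g2' w b) (w r * g2 r * nn m p (l2 - l1) g1 g1' b r) r := by
  have hs : HasDerivAt (fun r : ℝ => r + b) 1 r := (hasDerivAt_id r).add_const b
  have h := (D.dw r hr).mul (((((D.d2' r hr).mul (D.d1 r hr)).sub
    ((D.d2 r hr).mul (D.d1' r hr))).mul hs).sub ((D.d2 r hr).mul (D.d1 r hr)))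
  refine h.congr_deriv ?_
  unfold nn
  simp
  ring

lemma Dat.br_lim (D : Dat m p l1 l2 R g1 g1' g2 g2' w) (b : ℝ) :
    Filter.Tendsto (fun r => (g2' r * g1 r - g2 r * g1' r) * (r + b) - g2 r * g1 r)
      (nhdsWithin 0 (Set.Ioi 0)) (nhds b) := by
  simpa using (((D.t2'.mul D.t1).sub (D.t2.mul D.t1')).mul (id_lim.add_const b)).sub
    (D.t2.mul D.t1)

lemma Dat.X_lim (D : Dat m p l1 l2 R g1 g1' g2 g2' w) (b : ℝ) :
    Filter.Tendsto (XX g1 g1' g2 g2' w b) (nhdsWithin 0 (Set.Ioi 0)) (nhds 0) := by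
  have h := D.tw0.mul (D.br_lim b)
  rw [zero_mul] at h
  exact h

lemma Dat.X_R (D : Dat m p l1 l2 R g1 g1' g2 g2' w) (b : ℝ) : XX g1 g1' g2 g2' w b R = 0 := by
  simp [XX, D.e1, D.e2]

noncomputable def MM (m p d : ℝ) (g1 g1' w : ℝ → ℝ) (b r : ℝ) : ℝ :=
  nn m p d g1 g1' b r * w r * EE m p d b r

lemma Dat.M_hd (D : Dat m p l1 l2 R g1 g1' g2 g2' w) (b : ℝ) {r : ℝ} (hr : 0 < r) :
    HasDerivAt (MM m p (l2 - l1) g1 g1' w b)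
      (g1 r * w r * EE m p (l2 - l1) b r * zz m p l1 (l2 - l1) b r) r := by
  have hs : HasDerivAt (fun r : ℝ => r + b) 1 r := (hasDerivAt_id r).add_const b
  have hn : HasDerivAt (nn m p (l2 - l1) g1 g1' b)
      (-2 * (-(HH m p r * g1' r) - l1 * g1 r) - (-LL m p r * g1 r + HH m p r * g1' r)
        + ((L1 m p r * (r + b) + (LL m p r - (l2 - l1)) * 1) * g1 r
          + (LL m p r - (l2 - l1)) * (r + b) * g1' r)) r :=
    (((D.d1' r hr).const_mul (-2)).sub ((HH_hd m p hr).mul (D.d1 r hr))).add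
      ((((LL_hd m p hr).sub_const (l2 - l1)).mul hs).mul (D.d1 r hr))
  have hE : HasDerivAt (EE m p (l2 - l1) b) (EE m p (l2 - l1) b r *
      (-((-LL m p r * (r + b) + HH m p r * 1) / 2) - (l2 - l1) * (2 * (r + b)) / 4)) r := by
    have h2 : HasDerivAt (fun r : ℝ => (l2 - l1) * (r + b) ^ 2 / 4)
        ((l2 - l1) * (2 * (r + b)) / 4) r :=
      (((hs.pow 2).const_mul (l2 - l1)).div_const 4).congr_deriv (by simp)
    exact ((((HH_hd m p hr).mul hs).div_const 2).neg.sub h2).exp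
  refine ((hn.mul (D.dw r hr)).mul hE).congr_deriv ?_
  unfold zz nn
  simp only [Pi.mul_apply]
  ring

lemma Dat.M_lim (D : Dat m p l1 l2 R g1 g1' g2 g2' w) :
    Filter.Tendsto (MM m p (l2 - l1) g1 g1' w 0) (nhdsWithin 0 (Set.Ioi 0)) (nhds 0) := by
  have h1 : Filter.Tendsto (fun r => nn m p (l2 - l1) g1 g1' 0 r * w r)
      (nhdsWithin 0 (Set.Ioi 0)) (nhds 0) := by
    have h := (((D.tw0.mul D.t1').const_mul (-2)).sub (D.twH.mul D.t1)).add
      (((D.twL.mul id_lim).mul D.t1).sub (((D.tw0.mul id_lim).mul D.t1).const_mul (l2 - l1)))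
    simp only [zero_mul, mul_zero, sub_zero, add_zero] at h
    refine h.congr ?_
    intro r
    unfold nn
    ring
  refine squeeze_zero_norm' ?_ (by simpa using h1.norm)
  filter_upwards [self_mem_nhdsWithin] with r hr
  have hr : 0 < r := hr
  unfold MM
  rw [norm_mul]
  have hE : ‖EE m p (l2 - l1) 0 r‖ ≤ 1 := by
    unfold EE
    rw [Real.norm_eq_abs, Real.abs_exp, Real.exp_le_one_iff]
    have := tanh_pos' hr
    have h2 := D.delta_pos
    have h3 := D.hp
    have h4 : 0 < m := by linarith [D.hm]
    have h5 : 0 < HH m p r := by unfold HH; positivity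
    have h6 : 0 < HH m p r * (r + 0) / 2 := by rw [add_zero]; positivity
    have h7 : 0 ≤ (l2 - l1) * (r + 0) ^ 2 / 4 := by positivity
    linarith
  calc _ ≤ ‖nn m p (l2 - l1) g1 g1' 0 r * w r‖ * 1 := by gcongr
    _ = _ := by simp

/-- sign of M vs n -/
lemma Dat.M_sign (D : Dat m p l1 l2 R g1 g1' g2 g2' w) (b : ℝ) {r : ℝ} (hr : 0 < r) :
    (0 < nn m p (l2 - l1) g1 g1' b r → 0 < MM m p (l2 - l1) g1 g1' w b r) ∧
    (nn m p (l2 - l1) g1 g1' b r < 0 → MM m p (l2 - l1) g1 g1' w b r < 0) := by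
  have h1 := D.pw r hr
  have h2 : 0 < EE m p (l2 - l1) b r := Real.exp_pos _
  constructor
  · intro h; unfold MM; positivity
  · intro h; unfold MM
    exact mul_neg_of_neg_of_pos (mul_neg_of_neg_of_pos h h1) h2

lemma Dat.z_sign (D : Dat m p l1 l2 R g1 g1' g2 g2' w) (b : ℝ) {r : ℝ} (hr : 0 < r) (hrR : r < R) :
    (0 < g1 r * w r * EE m p (l2 - l1) b r * zz m p l1 (l2 - l1) b r →
      0 < zz m p l1 (l2 - l1) b r) ∧
    (g1 r * w r * EE m p (l2 - l1) b r * zz m p l1 (l2 - l1) b r < 0 →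
      zz m p l1 (l2 - l1) b r < 0) := by
  have h1 := D.pw r hr
  have h2 : 0 < EE m p (l2 - l1) b r := Real.exp_pos _
  have h3 := D.p1 r hr hrR
  have h4 : 0 < g1 r * w r * EE m p (l2 - l1) b r := by positivity
  exact ⟨fun h => (mul_pos_iff_of_pos_left h4).1 h, fun h => by
    by_contra hn; push Not at hn; have := mul_nonneg h4.le hn; linarith⟩

lemma Dat.n_sign (D : Dat m p l1 l2 R g1 g1' g2 g2' w) (b : ℝ) {r : ℝ} (hr : 0 < r) (hrR : r < R) :
    (0 < w r * g2 r * nn m p (l2 - l1) g1 g1' b r → 0 < nn m p (l2 - l1) g1 g1' b r) ∧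
    (w r * g2 r * nn m p (l2 - l1) g1 g1' b r < 0 → nn m p (l2 - l1) g1 g1' b r < 0) := by
  have h1 := D.pw r hr
  have h3 := D.p2 r hr hrR
  have h4 : 0 < w r * g2 r := by positivity
  exact ⟨fun h => (mul_pos_iff_of_pos_left h4).1 h, fun h => by
    by_contra hn; push Not at hn; have := mul_nonneg h4.le hn; linarith⟩

/-- n positive then negative: z negative in between -/
lemma Dat.z_neg (D : Dat m p l1 l2 R g1 g1' g2 g2' w) (b : ℝ) {r s : ℝ} (hr : 0 < r) (hrs : r < s)
    (hs : s < R) (h1 : 0 < nn m p (l2 - l1) g1 g1' b r) (h2 : nn m p (l2 - l1) g1 g1' b s < 0) :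
    ∃ c ∈ Set.Ioo r s, zz m p l1 (l2 - l1) b c < 0 := by
  have a1 := (D.M_sign b hr).1 h1
  have a2 := (D.M_sign b (hr.trans hrs)).2 h2
  obtain ⟨c, hc, e⟩ := mvt_neg _ _ hrs (fun u hu => D.M_hd b (r := u) (by linarith [hu.1]))
    (a2.trans a1)
  exact ⟨c, hc, (D.z_sign b (hr.trans hc.1) (hc.2.trans hs)).2 e⟩

lemma Dat.z_pos (D : Dat m p l1 l2 R g1 g1' g2 g2' w) (b : ℝ) {r s : ℝ} (hr : 0 < r) (hrs : r < s)
    (hs : s < R) (h1 : nn m p (l2 - l1) g1 g1' b r < 0) (h2 : 0 < nn m p (l2 - l1) g1 g1' b s) :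
    ∃ c ∈ Set.Ioo r s, 0 < zz m p l1 (l2 - l1) b c := by
  have a1 := (D.M_sign b hr).2 h1
  have a2 := (D.M_sign b (hr.trans hrs)).1 h2
  obtain ⟨c, hc, e⟩ := mvt_pos _ _ hrs (fun u hu => D.M_hd b (r := u) (by linarith [hu.1]))
    (a1.trans a2)
  exact ⟨c, hc, (D.z_sign b (hr.trans hc.1) (hc.2.trans hs)).1 e⟩

lemma T_coef {b r : ℝ} (hp : 1 ≤ p) (hm : 2 * p + 1 ≤ m) (hb : 0 ≤ b) (hr : 0 < r) :
    0 < (r+b)^2 * LL m p r * (-L1 m p r) := by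
  have h1 := LL_pos hp hm hr
  have h2 : 0 < -L1 m p r := by linarith [L1_neg hp hm hr]
  positivity

lemma T_neg {l d b r s : ℝ} (hp : 1 ≤ p) (hm : 2 * p + 1 ≤ m) (hb : 0 ≤ b) (hr : 0 < r)
    (hrs : r < s) (h1 : 0 < zz m p l d b r) (h2 : zz m p l d b s < 0) :
    ∃ c ∈ Set.Ioo r s, TT d m p b c < 0 := by
  obtain ⟨c, hc, e⟩ := mvt_neg _ _ hrs
    (fun u hu => zz_hd (l := l) (d := d) hp hm hb (r := u) (by linarith [hu.1])) (h2.trans h1)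
  refine ⟨c, hc, ?_⟩
  have := T_coef hp hm hb (hr.trans hc.1)
  by_contra hn
  push Not at hn
  have := mul_nonneg this.le hn
  linarith

lemma T_pos {l d b r s : ℝ} (hp : 1 ≤ p) (hm : 2 * p + 1 ≤ m) (hb : 0 ≤ b) (hr : 0 < r)
    (hrs : r < s) (h1 : zz m p l d b r < 0) (h2 : 0 < zz m p l d b s) :
    ∃ c ∈ Set.Ioo r s, 0 < TT d m p b c := by
  obtain ⟨c, hc, e⟩ := mvt_pos _ _ hrs
    (fun u hu => zz_hd (l := l) (d := d) hp hm hb (r := u) (by linarith [hu.1])) (h1.trans h2)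
  refine ⟨c, hc, ?_⟩
  exact (mul_pos_iff_of_pos_left (T_coef hp hm hb (hr.trans hc.1))).1 e

lemma Dat.X0 (D : Dat m p l1 l2 R g1 g1' g2 g2' w) {r : ℝ} (hr : 0 < r) (hrR : r < R) :
    XX g1 g1' g2 g2' w 0 r ≤ 0 := by
  by_contra hn
  push Not at hn
  obtain ⟨s1, hs1, a1⟩ := lim_pos _ _ hr (fun u hu => D.X_hd 0 (r := u) hu.1) (D.X_lim 0) hn
  have a1 := (D.n_sign 0 hs1.1 (hs1.2.trans hrR)).1 a1
  obtain ⟨s2, hs2, a2⟩ := mvt_neg _ _ hrR (fun u hu => D.X_hd 0 (r := u) (by linarith [hu.1]))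
    (by rw [D.X_R]; exact hn)
  have a2 := (D.n_sign 0 (hr.trans hs2.1) hs2.2).2 a2
  obtain ⟨t0, ht0, b0⟩ := lim_pos _ _ hs1.1 (fun u hu => D.M_hd 0 (r := u) hu.1) D.M_lim
    ((D.M_sign 0 hs1.1).1 a1)
  have b0 := (D.z_sign 0 ht0.1 (by linarith [ht0.2, hs1.2])).1 b0
  obtain ⟨t1, ht1, b1⟩ := D.z_neg 0 hs1.1 (hs1.2.trans hs2.1) hs2.2 a1 a2
  obtain ⟨c, hc, e⟩ := T_neg D.hp D.hm le_rfl ht0.1 (ht0.2.trans ht1.1) b0 b1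
  have := TT_nonneg D.hp D.hm D.delta_pos.le (ht0.1.trans hc.1)
  linarith

lemma Dat.rG (D : Dat m p l1 l2 R g1 g1' g2 g2' w) {r : ℝ} (hr : 0 < r) (hrR : r < R) :
    (g2' r * g1 r - g2 r * g1' r) * r ≤ g2 r * g1 r := by
  have h := D.X0 hr hrR
  have hw := D.pw r hr
  unfold XX at h
  by_contra hn
  push Not at hn
  have := mul_pos hw (show 0 < (g2' r * g1 r - g2 r * g1' r) * (r + 0) - g2 r * g1 r by
    rw [add_zero]; linarith)
  linarith

lemma Dat.S_nonpos (D : Dat m p l1 l2 R g1 g1' g2 g2' w) {r : ℝ} (hr : 0 < r) (hrR : r < R) :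
    (-2 * g1' r - HH m p r * g1 r) * (g2' r * g1 r - g2 r * g1' r)
      + (LL m p r - (l2 - l1)) * g2 r * g1 r ^ 2 ≤ 0 := by
  by_contra hn
  push Not at hn
  have hG := D.W_pos hr hrR
  have hG' := hG.ne'
  obtain ⟨b, hb⟩ : ∃ b, b = g2 r * g1 r / (g2' r * g1 r - g2 r * g1' r) - r := ⟨_, rfl⟩
  have hb0 : 0 ≤ b := by
    rw [hb, sub_nonneg, le_div_iff₀ hG]
    linarith [D.rG hr hrR]
  have hrb : r + b = g2 r * g1 r / (g2' r * g1 r - g2 r * g1' r) := by rw [hb]; ring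
  have hX : XX g1 g1' g2 g2' w b r = 0 := by
    unfold XX; rw [hrb]; field_simp; ring
  have hnr : 0 < nn m p (l2 - l1) g1 g1' b r := by
    have : nn m p (l2 - l1) g1 g1' b r = ((-2 * g1' r - HH m p r * g1 r) *
      (g2' r * g1 r - g2 r * g1' r) + (LL m p r - (l2 - l1)) * g2 r * g1 r ^ 2) /
        (g2' r * g1 r - g2 r * g1' r) := by
      unfold nn; rw [hrb, eq_div_iff hG', add_mul]
      have e : ∀ P : ℝ, P ≠ 0 → (LL m p r - (l2 - l1)) * (g2 r * g1 r / P) * g1 r * P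
        = (LL m p r - (l2 - l1)) * g2 r * g1 r ^ 2 := by intro P hP; field_simp
      rw [e _ hG']
    rw [this]; positivity
  have hw := D.pw r hr
  have hg2 := D.p2 r hr hrR
  obtain ⟨⟨ra, hra, xa⟩, ⟨rb, hrb', xb⟩⟩ := sign_aux (D.X_hd b hr) hX (by positivity) hr hrR
  obtain ⟨s3, hs3, n3⟩ := mvt_neg _ _ hrb'.2
    (fun u hu => D.X_hd b (r := u) (by linarith [hu.1, hrb'.1])) (by rw [D.X_R]; exact xb)
  have n3 := (D.n_sign b (by linarith [hs3.1, hrb'.1]) hs3.2).2 n3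
  obtain ⟨t2, ht2, z2⟩ := D.z_neg b hr (hrb'.1.trans hs3.1) hs3.2 hnr n3
  rcases hb0.eq_or_lt with h0 | h0
  · obtain ⟨s1, hs1, n1⟩ := lim_neg _ _ hra.1 (fun u hu => D.X_hd b (r := u) hu.1) (D.X_lim b) xa
    have n1 := (D.n_sign b hs1.1 (by linarith [hs1.2, hra.2])).2 n1
    obtain ⟨t1, ht1, z1⟩ := D.z_pos b hs1.1 (hs1.2.trans hra.2) hrR n1 hnr
    obtain ⟨c, hc, e⟩ := T_neg D.hp D.hm hb0 (hs1.1.trans ht1.1) (ht1.2.trans ht2.1) z1 z2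
    have hc0 : 0 < c := by linarith [hs1.1, ht1.1, hc.1]
    have := TT_nonneg D.hp D.hm D.delta_pos.le hc0
    rw [← h0] at e
    linarith
  · have hev := (D.br_lim b).eventually (lt_mem_nhds h0)
    obtain ⟨r0, h1, hr0⟩ := (hev.and (Ioo_mem_nhdsGT hra.1)).exists
    have x0 : 0 < XX g1 g1' g2 g2' w b r0 := mul_pos (D.pw r0 hr0.1) h1
    obtain ⟨s0, hs0, n0⟩ := lim_pos _ _ hr0.1 (fun u hu => D.X_hd b (r := u) hu.1) (D.X_lim b) x0
    have hs0R : s0 < R := by linarith [hs0.2, hr0.2, hra.2]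
    have n0 := (D.n_sign b hs0.1 hs0R).1 n0
    obtain ⟨s1, hs1, n1⟩ := mvt_neg _ _ hr0.2
      (fun u hu => D.X_hd b (r := u) (by linarith [hu.1, hr0.1])) (xa.trans x0)
    have hs10 : 0 < s1 := hr0.1.trans hs1.1
    have hs1r : s1 < r := hs1.2.trans hra.2
    have n1 := (D.n_sign b hs10 (hs1r.trans hrR)).2 n1
    obtain ⟨t0, ht0, z0⟩ := D.z_neg b hs0.1 (hs0.2.trans hs1.1) (hs1r.trans hrR) n0 n1
    obtain ⟨t1, ht1, z1⟩ := D.z_pos b hs10 hs1r hrR n1 hnr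
    have ht00 : 0 < t0 := hs0.1.trans ht0.1
    obtain ⟨c, hc, e⟩ := T_neg D.hp D.hm hb0 (hs10.trans ht1.1) (ht1.2.trans ht2.1) z1 z2
    obtain ⟨c', hc', e'⟩ := T_pos D.hp D.hm hb0 ht00 (ht0.2.trans ht1.1) z0 z1
    have := TT_mono D.hp D.hm D.delta_pos.le hb0 (ht00.trans hc'.1) (hc'.2.trans hc.1).le
    linarith

lemma Dat.main (D : Dat m p l1 l2 R g1 g1' g2 g2' w) :
    AntitoneOn (fun r => ((g2' r * g1 r - g2 r * g1' r) / g1 r ^ 2) ^ 2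
      + LL m p r * (g2 r / g1 r) ^ 2) (Set.Ioo 0 R) := by
  have hG : ∀ r, 0 < r → r < R → HasDerivAt (fun r => g2 r / g1 r)
      ((g2' r * g1 r - g2 r * g1' r) / g1 r ^ 2) r := fun r hr hrR =>
    (D.d2 r hr).div (D.d1 r hr) (D.p1 r hr hrR).ne'
  have hG' : ∀ r, 0 < r → r < R → HasDerivAt (fun r => (g2' r * g1 r - g2 r * g1' r) / g1 r ^ 2)
      (((-2 * g1' r - HH m p r * g1 r) * (g2' r * g1 r - g2 r * g1' r)
      + (LL m p r - (l2 - l1)) * g2 r * g1 r ^ 2) / g1 r ^ 3) r := by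
    intro r hr hrR
    have h1 := (D.p1 r hr hrR).ne'
    have h := (((D.d2' r hr).mul (D.d1 r hr)).sub ((D.d2 r hr).mul (D.d1' r hr))).div
      ((D.d1 r hr).pow 2) (pow_ne_zero 2 h1)
    refine h.congr_deriv ?_
    simp
    field_simp
    ring
  have hB : ∀ r, 0 < r → r < R → ∃ f', HasDerivAt
      (fun r => ((g2' r * g1 r - g2 r * g1' r) / g1 r ^ 2) ^ 2
      + LL m p r * (g2 r / g1 r) ^ 2) f' r ∧ f' ≤ 0 := by
    intro r hr hrR
    refine ⟨_, ((hG' r hr hrR).pow 2).add ((LL_hd m p hr).mul ((hG r hr hrR).pow 2)), ?_⟩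
    have h1 := D.p1 r hr hrR
    have h2 := D.p2 r hr hrR
    have hS : ((-2 * g1' r - HH m p r * g1 r) * (g2' r * g1 r - g2 r * g1' r)
      + (LL m p r - (l2 - l1)) * g2 r * g1 r ^ 2) / g1 r ^ 3 ≤ 0 :=
      div_nonpos_of_nonpos_of_nonneg (D.S_nonpos hr hrR) (by positivity)
    have hQ : (g2' r * g1 r - g2 r * g1' r) / g1 r ^ 2 * r ≤ g2 r / g1 r := by
      have e : g2 r / g1 r = g2 r * g1 r / g1 r ^ 2 := by field_simp
      rw [e, div_mul_eq_mul_div]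
      have := D.rG hr hrR
      gcongr
    have hP : 0 ≤ (g2' r * g1 r - g2 r * g1' r) / g1 r ^ 2 :=
      div_nonneg (D.W_pos hr hrR).le (by positivity)
    have hg : 0 < g2 r / g1 r := div_pos h2 h1
    have hL := LL_pos D.hp D.hm hr
    have hLL := LL_L1 D.hp D.hm hr
    generalize (g2' r * g1 r - g2 r * g1' r) / g1 r ^ 2 = P at *
    generalize ((-2 * g1' r - HH m p r * g1 r) * (g2' r * g1 r - g2 r * g1' r)
      + (LL m p r - (l2 - l1)) * g2 r * g1 r ^ 2) / g1 r ^ 3 = S at *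
    generalize g2 r / g1 r = G at *
    have k1 : P * S ≤ 0 := mul_nonpos_of_nonneg_of_nonpos hP hS
    have k2 : r * (L1 m p r * G ^ 2 + LL m p r * (2 * G * P)) ≤ 0 := by
      have a1 : LL m p r * (2 * G) * (P * r) ≤ LL m p r * (2 * G) * G := by gcongr
      have a2 : (2 * LL m p r + r * L1 m p r) * G ^ 2 ≤ 0 :=
        mul_nonpos_of_nonpos_of_nonneg hLL (by positivity)
      nlinarith
    have k3 : L1 m p r * G ^ 2 + LL m p r * (2 * G * P) ≤ 0 := by
      by_contra hn
      push Not at hn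
      have := mul_pos hr hn
      linarith
    norm_num
    linarith
  have hB' : ∀ r, ∃ f', 0 < r → r < R → HasDerivAt
      (fun r => ((g2' r * g1 r - g2 r * g1' r) / g1 r ^ 2) ^ 2
      + LL m p r * (g2 r / g1 r) ^ 2) f' r ∧ f' ≤ 0 := by
    intro r
    by_cases h : 0 < r ∧ r < R
    · obtain ⟨f', hf⟩ := hB r h.1 h.2
      exact ⟨f', fun _ _ => hf⟩
    · exact ⟨0, fun a b => (h ⟨a, b⟩).elim⟩
  choose f' hf using hB'
  refine antitoneOn_of_hasDerivWithinAt_nonpos (convex_Ioo 0 R) (f' := f')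
    (fun x hx => ((hf x hx.1 hx.2).1).continuousAt.continuousWithinAt) ?_ ?_
  · intro x hx
    rw [interior_Ioo] at hx ⊢
    exact ((hf x hx.1 hx.2).1).hasDerivWithinAt
  · intro x hx
    rw [interior_Ioo] at hx
    exact (hf x hx.1 hx.2).2

end

end PPW

lemma PPW.w_hd (j i : ℕ) {r : ℝ} (hr : 0 < r) :
    HasDerivAt (fun r => Real.sinh r ^ (j + 2) * Real.cosh r ^ (i + 1))
      (PPW.HH ((j + 2 : ℕ) : ℝ) ((i + 1 : ℕ) : ℝ) r *
        (Real.sinh r ^ (j + 2) * Real.cosh r ^ (i + 1))) r := by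
  have h := ((Real.hasDerivAt_sinh r).pow (j+2)).mul ((Real.hasDerivAt_cosh r).pow (i+1))
  refine h.congr_deriv ?_
  have h1 := (Real.sinh_pos_iff.2 hr).ne'
  have h2 := (Real.cosh_pos r).ne'
  unfold PPW.HH
  rw [Real.tanh_eq_sinh_div_cosh]
  simp
  field_simp
  ring

lemma PPW.w_lim (j i : ℕ) (hj : 1 ≤ j) :
    Filter.Tendsto (fun r => Real.sinh r ^ (j + 2) * Real.cosh r ^ (i + 1) / Real.tanh r ^ 2)
      (nhdsWithin 0 (Set.Ioi 0)) (nhds 0) := by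
  have hc : Continuous (fun r => Real.sinh r ^ j * Real.cosh r ^ (i + 3)) :=
    (Real.continuous_sinh.pow j).mul (Real.continuous_cosh.pow (i+3))
  have h := hc.tendsto 0
  have hj' : j ≠ 0 := by omega
  simp [hj'] at h
  refine (h.mono_left nhdsWithin_le_nhds).congr' ?_
  filter_upwards [self_mem_nhdsWithin] with r hr
  have h1 := (Real.sinh_pos_iff.2 hr).ne'
  have h2 := (Real.cosh_pos r).ne'
  rw [Real.tanh_eq_sinh_div_cosh]
  field_simp
  ring

theorem stmt_8
    (k n : ℕ) (hk : k = 2 ∨ k = 4 ∨ k = 8) (hn : 2 ≤ n) (hk8 : k = 8 → n = 2)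
    (H : ℝ → ℝ)
    (hH : ∀ r : ℝ, 0 < r →
      H r = ((k : ℝ) * n - 1) * (Real.cosh r / Real.sinh r) + ((k : ℝ) - 1) * Real.tanh r)
    (R lam1 : ℝ) (hR : 0 < R) (hlam1 : 0 < lam1)
    (g₁ g₁' g₁'' : ℝ → ℝ)
    (hg₁d : ∀ r : ℝ, 0 < r → HasDerivAt g₁ (g₁' r) r)
    (hg₁d' : ∀ r : ℝ, 0 < r → HasDerivAt g₁' (g₁'' r) r)
    (hg₁c : ContinuousOn g₁'' (Set.Ioi 0))
    (hg₁ode : ∀ r : ℝ, 0 < r → g₁'' r + H r * g₁' r + lam1 * g₁ r = 0)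
    (hg₁pos : ∀ r ∈ Set.Ioo (0 : ℝ) R, 0 < g₁ r)
    (hg₁R : g₁ R = 0)
    (hg₁lim : Filter.Tendsto g₁ (nhdsWithin 0 (Set.Ioi 0)) (nhds 1))
    (hg₁'lim : Filter.Tendsto g₁' (nhdsWithin 0 (Set.Ioi 0)) (nhds 0))
    (Λ : ℝ → ℝ)
    (hΛ : ∀ r : ℝ, 0 < r →
      Λ r = ((k : ℝ) * n - 1) / Real.sinh r ^ 2 - ((k : ℝ) - 1) / Real.cosh r ^ 2)
    (lam2 : ℝ)
    (g₂ g₂' g₂'' : ℝ → ℝ)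
    (hg₂d : ∀ r : ℝ, 0 < r → HasDerivAt g₂ (g₂' r) r)
    (hg₂d' : ∀ r : ℝ, 0 < r → HasDerivAt g₂' (g₂'' r) r)
    (hg₂c : ContinuousOn g₂'' (Set.Ioi 0))
    (hg₂ode : ∀ r : ℝ, 0 < r → g₂'' r + H r * g₂' r + (lam2 - Λ r) * g₂ r = 0)
    (hg₂pos : ∀ r ∈ Set.Ioo (0 : ℝ) R, 0 < g₂ r)
    (hg₂R : g₂ R = 0)
    (hg₂lim : Filter.Tendsto (fun r => g₂ r / r) (nhdsWithin 0 (Set.Ioi 0)) (nhds 1))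
    (hg₂'lim : Filter.Tendsto g₂' (nhdsWithin 0 (Set.Ioi 0)) (nhds 1))
    (hubar1 : ∃ v : ℝ → ℝ, ContDiffOn ℝ 1 v (Set.Icc 0 R) ∧
      (∀ r ∈ Set.Ioo (0 : ℝ) R,
        v r = Real.sinh r ^ (((k : ℝ) * n - 1) / 2) * Real.cosh r ^ (((k : ℝ) - 1) / 2) * g₁ r) ∧
      v 0 = 0 ∧ v R = 0)
    (hubar2 : ∃ v : ℝ → ℝ, ContDiffOn ℝ 1 v (Set.Icc 0 R) ∧
      (∀ r ∈ Set.Ioo (0 : ℝ) R,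
        v r = Real.sinh r ^ (((k : ℝ) * n - 1) / 2) * Real.cosh r ^ (((k : ℝ) - 1) / 2) * g₂ r) ∧
      v 0 = 0 ∧ v R = 0) :
    AntitoneOn
      (fun r => (deriv (fun s => g₂ s / g₁ s) r) ^ 2 + Λ r * (g₂ r / g₁ r) ^ 2)
      (Set.Ioo (0 : ℝ) R) := by
  obtain ⟨i, hi⟩ : ∃ i, k = (i + 1) + 1 := ⟨k - 2, by omega⟩
  obtain ⟨j, hj⟩ : ∃ j, k * n = (j + 2) + 1 := ⟨k * n - 3, by
    have : 2 * 2 ≤ k * n := Nat.mul_le_mul (by omega) hn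
    omega⟩
  have hij : 2 * (i + 1) + 1 ≤ j + 2 := by
    have : k * 2 ≤ k * n := Nat.mul_le_mul le_rfl hn
    omega
  have hj1 : 1 ≤ j := by omega
  have hp1 : (k : ℝ) - 1 = ((i + 1 : ℕ) : ℝ) := by rw [hi]; push_cast; ring
  have hm1 : (k : ℝ) * n - 1 = ((j + 2 : ℕ) : ℝ) := by
    have : ((k * n : ℕ) : ℝ) = (((j + 2) + 1 : ℕ) : ℝ) := by rw [hj]
    push_cast at this ⊢
    linarith
  have hH' : ∀ r : ℝ, 0 < r → H r = PPW.HH ((j + 2 : ℕ) : ℝ) ((i + 1 : ℕ) : ℝ) r := by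
    intro r hr
    have h1 := (Real.sinh_pos_iff.2 hr).ne'
    have h2 := (Real.cosh_pos r).ne'
    rw [hH r hr, hp1, hm1]
    unfold PPW.HH
    rw [Real.tanh_eq_sinh_div_cosh]
    field_simp
  have hL' : ∀ r : ℝ, 0 < r → Λ r = PPW.LL ((j + 2 : ℕ) : ℝ) ((i + 1 : ℕ) : ℝ) r := by
    intro r hr
    have h1 := (Real.sinh_pos_iff.2 hr).ne'
    have h2 := (Real.cosh_pos r).ne'
    have h3 := Real.cosh_sq r
    rw [hΛ r hr, hp1, hm1]
    generalize ((j + 2 : ℕ) : ℝ) = m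
    generalize ((i + 1 : ℕ) : ℝ) = p
    unfold PPW.LL
    rw [Real.tanh_eq_sinh_div_cosh]
    have e1 : m / (Real.sinh r / Real.cosh r) ^ 2 = m / Real.sinh r ^ 2 + m := by
      field_simp
      rw [h3]; ring
    have e2 : p * (Real.sinh r / Real.cosh r) ^ 2 = p - p / Real.cosh r ^ 2 := by
      field_simp
      rw [h3]; ring
    rw [e1, e2]
    ring
  have D : PPW.Dat ((j + 2 : ℕ) : ℝ) ((i + 1 : ℕ) : ℝ) lam1 lam2 R g₁ g₁' g₂ g₂'
      (fun r => Real.sinh r ^ (j + 2) * Real.cosh r ^ (i + 1)) :=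
    { hp := by push_cast; have : (0:ℝ) ≤ i := Nat.cast_nonneg i; linarith
      hm := by exact_mod_cast hij
      hR := hR
      d1 := hg₁d
      d1' := fun r hr => (hg₁d' r hr).congr_deriv (by
        have := hg₁ode r hr
        rw [hH' r hr] at this
        linarith)
      d2 := hg₂d
      d2' := fun r hr => (hg₂d' r hr).congr_deriv (by
        have := hg₂ode r hr
        rw [hH' r hr, hL' r hr] at this
        linarith)
      p1 := fun r h1 h2 => hg₁pos r ⟨h1, h2⟩
      p2 := fun r h1 h2 => hg₂pos r ⟨h1, h2⟩
      e1 := hg₁R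
      e2 := hg₂R
      t1 := hg₁lim
      t1' := hg₁'lim
      t2 := by
        have h := hg₂lim.mul PPW.id_lim
        rw [mul_zero] at h
        refine h.congr' ?_
        filter_upwards [self_mem_nhdsWithin] with r hr
        exact div_mul_cancel₀ _ (ne_of_gt hr)
      t2' := hg₂'lim
      dw := fun r hr => PPW.w_hd j i hr
      pw := fun r hr => by
        have h1 := Real.sinh_pos_iff.2 hr
        have h2 := Real.cosh_pos r
        positivity
      tw := PPW.w_lim j i hj1 }
  refine D.main.congr ?_
  intro r hr
  have hd : deriv (fun s => g₂ s / g₁ s) r = (g₂' r * g₁ r - g₂ r * g₁' r) / g₁ r ^ 2 :=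
    ((hg₂d r hr.1).div (hg₁d r hr.1) (hg₁pos r hr).ne').deriv
  simp only [hd, hL' r hr.1]
end

section
/- The function q(r) = r·G′(r)/G(r) satisfies 0 ≤ q(r) ≤ 1 and q′(r) ≤ 0 for every r ∈ (0,R). -/
namespace Aux9
open Real Set Filter Topology

lemma mono_of_deriv {f f' : ℝ → ℝ} (h : ∀ x, 0 < x → HasDerivAt f (f' x) x)
    (h' : ∀ x, 0 < x → 0 ≤ f' x) : MonotoneOn f (Ioi 0) := by
  apply monotoneOn_of_deriv_nonneg (convex_Ioi 0)
  · intro x hx; exact (h x hx).continuousAt.continuousWithinAt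
  · intro x hx
    rw [interior_Ioi] at hx
    exact (h x hx).differentiableAt.differentiableWithinAt
  · intro x hx
    rw [interior_Ioi] at hx
    rw [(h x hx).deriv]; exact h' x hx

lemma nonneg_of_deriv {f f' : ℝ → ℝ} (h : ∀ x, HasDerivAt f (f' x) x)
    (h' : ∀ x, 0 < x → 0 ≤ f' x) (h0 : f 0 = 0) (x : ℝ) (hx : 0 < x) : 0 ≤ f x := by
  have : MonotoneOn f (Ici 0) := by
    apply monotoneOn_of_deriv_nonneg (convex_Ici 0)
    · intro x hx; exact (h x).continuousAt.continuousWithinAt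
    · intro x hx
      exact (h x).differentiableAt.differentiableWithinAt
    · intro x hx
      rw [interior_Ici] at hx
      rw [(h x).deriv]; exact h' x hx
  have := this (self_mem_Ici) (mem_Ici.2 hx.le) hx.le
  rwa [h0] at this

lemma one_le_c (x : ℝ) : 1 ≤ cosh x := Real.one_le_cosh x

lemma s_sq (x : ℝ) : sinh x ^ 2 = cosh x ^ 2 - 1 := by
  have := Real.cosh_sq x; linarith

lemma low12 (x : ℝ) (hx : 0 < x) :
    sinh x * (105 + 25 * (cosh x - 1)) ≤ x * (105 + 60 * (cosh x - 1) + 6 * (cosh x - 1)^2) := by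
  have hD : ∀ x : ℝ, 0 < 105 + 60 * (cosh x - 1) + 6 * (cosh x - 1)^2 := by
    intro x; have := one_le_c x; nlinarith [sq_nonneg (cosh x - 1)]
  have key := nonneg_of_deriv (f := fun x => x - sinh x * (105 + 25 * (cosh x - 1)) / (105 + 60 * (cosh x - 1) + 6 * (cosh x - 1)^2))
    (f' := fun x => 36 * (cosh x - 1)^4 / (105 + 60 * (cosh x - 1) + 6 * (cosh x - 1)^2)^2) ?_ ?_ (by simp) x hx
  · simp only [sub_nonneg] at key
    rwa [div_le_iff₀ (hD x)] at key
  · intro x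
    have hs := Real.hasDerivAt_sinh x
    have hc := (Real.hasDerivAt_cosh x).sub_const 1
    have hd := (((hc.const_mul 60).const_add 105).add ((hc.pow 2).const_mul 6))
    have := (hasDerivAt_id x).sub ((hs.mul ((hc.const_mul 25).const_add 105)).div hd (hD x).ne')
    refine (this.congr_deriv ?_)
    have h1 := (hD x).ne'
    simp only [Pi.add_apply, Pi.mul_apply, Pi.pow_apply, Nat.cast_ofNat, Nat.add_one_sub_one, pow_one]
    rw [eq_div_iff (pow_ne_zero 2 h1), sub_mul, div_mul_cancel₀ _ (pow_ne_zero 2 h1)]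
    have := s_sq x
    generalize cosh x = c at *
    generalize sinh x = s at *
    ring_nf
    rw [this]
    ring
  · intro x hx
    have := one_le_c x
    positivity

lemma up11 (x : ℝ) (hx : 0 < x) :
    x * (15 + 6 * (cosh x - 1)) ≤ sinh x * (15 + (cosh x - 1)) := by
  have hD : ∀ x : ℝ, 0 < 15 + 6 * (cosh x - 1) := by
    intro x; have := one_le_c x; linarith
  have key := nonneg_of_deriv (f := fun x => sinh x * (15 + (cosh x - 1)) / (15 + 6 * (cosh x - 1)) - x)
    (f' := fun x => 6 * (cosh x - 1)^3 / (15 + 6 * (cosh x - 1))^2) ?_ ?_ (by simp) x hx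
  · simp only [sub_nonneg] at key
    rwa [le_div_iff₀ (hD x)] at key
  · intro x
    have hs := Real.hasDerivAt_sinh x
    have hc := (Real.hasDerivAt_cosh x).sub_const 1
    have hd := (hc.const_mul 6).const_add 15
    have := ((hs.mul (hc.const_add 15)).div hd (hD x).ne').sub (hasDerivAt_id x)
    refine (this.congr_deriv ?_)
    have h1 := (hD x).ne'
    simp only [Pi.add_apply, Pi.mul_apply, Pi.pow_apply, Nat.cast_ofNat, Nat.add_one_sub_one, pow_one]
    rw [eq_div_iff (pow_ne_zero 2 h1), sub_mul, div_mul_cancel₀ _ (pow_ne_zero 2 h1)]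
    have := s_sq x
    generalize cosh x = c at *
    generalize sinh x = s at *
    ring_nf
    rw [this]
    ring
  · intro x hx
    have : 0 ≤ cosh x - 1 := by have := one_le_c x; linarith
    positivity

lemma up22 (x : ℝ) (hx : 0 < x) :
    x * (315 + 210 * (cosh x - 1) + 30 * (cosh x - 1)^2) ≤ sinh x * (315 + 105 * (cosh x - 1) + 2 * (cosh x - 1)^2) := by
  have hD : ∀ x : ℝ, 0 < 315 + 210 * (cosh x - 1) + 30 * (cosh x - 1)^2 := by
    intro x; have := one_le_c x; nlinarith [sq_nonneg (cosh x - 1)]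
  have key := nonneg_of_deriv (f := fun x => sinh x * (315 + 105 * (cosh x - 1) + 2 * (cosh x - 1)^2) / (315 + 210 * (cosh x - 1) + 30 * (cosh x - 1)^2) - x)
    (f' := fun x => 60 * (cosh x - 1)^5 / (315 + 210 * (cosh x - 1) + 30 * (cosh x - 1)^2)^2) ?_ ?_ (by simp) x hx
  · simp only [sub_nonneg] at key
    rwa [le_div_iff₀ (hD x)] at key
  · intro x
    have hs := Real.hasDerivAt_sinh x
    have hc := (Real.hasDerivAt_cosh x).sub_const 1
    have hd := (((hc.const_mul 210).const_add 315).add ((hc.pow 2).const_mul 30))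
    have := ((hs.mul (((hc.const_mul 105).const_add 315).add ((hc.pow 2).const_mul 2))).div hd (hD x).ne').sub (hasDerivAt_id x)
    refine (this.congr_deriv ?_)
    have h1 := (hD x).ne'
    simp only [Pi.add_apply, Pi.mul_apply, Pi.pow_apply, Nat.cast_ofNat, Nat.add_one_sub_one, pow_one]
    rw [eq_div_iff (pow_ne_zero 2 h1), sub_mul, div_mul_cancel₀ _ (pow_ne_zero 2 h1)]
    have := s_sq x
    generalize cosh x = c at *
    generalize sinh x = s at *
    ring_nf
    rw [this]
    ring
  · intro x hx
    have : 0 ≤ cosh x - 1 := by have := one_le_c x; linarith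
    positivity


lemma lower_use {x s N D A B : ℝ} (h : s * N ≤ x * D) (hD : 0 < D) (hA : 0 ≤ A) (hs : 0 < s)
    (h2 : 0 ≤ A * N - B * D) : s * B ≤ x * A := by
  have h3 : s * (B * D) ≤ s * (A * N) := mul_le_mul_of_nonneg_left (by linarith) hs.le
  have h4 : A * (s * N) ≤ A * (x * D) := mul_le_mul_of_nonneg_left h hA
  have : (s * B) * D ≤ (x * A) * D := by nlinarith
  exact le_of_mul_le_mul_right this hD

lemma upper_use {x s N D A B : ℝ} (h : x * D ≤ s * N) (hD : 0 < D) (hA : 0 ≤ A) (hs : 0 < s)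
    (h2 : 0 ≤ B * D - A * N) : x * A ≤ s * B := by
  have h3 : s * (A * N) ≤ s * (B * D) := mul_le_mul_of_nonneg_left (by linarith) hs.le
  have h4 : A * (x * D) ≤ A * (s * N) := mul_le_mul_of_nonneg_left h hA
  have : (x * A) * D ≤ (s * B) * D := by nlinarith
  exact le_of_mul_le_mul_right this hD

lemma s_pos {x : ℝ} (hx : 0 < x) : 0 < sinh x := Real.sinh_pos_iff.2 hx

lemma exu (x : ℝ) : ∃ u, 0 ≤ u ∧ cosh x = 1 + u := ⟨cosh x - 1, by linarith [one_le_c x], by ring⟩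

lemma exv {g : ℝ} (hg : 1 ≤ g) : ∃ v, 0 ≤ v ∧ g = 1 + v := ⟨g - 1, by linarith, by ring⟩

lemma ineq1 {x g : ℝ} (hx : 0 < x) (hg : 1 ≤ g) :
    sinh x * (3 * (g * cosh x ^ 2 + (1 + g^2) * cosh x + g)) ≤
      x * (g * cosh x ^ 3 + 2 * (1 + g^2) * cosh x ^ 2 + 5 * g * cosh x + (1 + g^2)) := by
  have h := low12 x hx
  have hs := s_pos hx
  obtain ⟨u, hu, hc⟩ := exu x
  obtain ⟨v, hv, rfl⟩ := exv hg
  rw [hc] at h ⊢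
  simp only [add_sub_cancel_left] at h
  refine lower_use h (by positivity) (by positivity) hs ?_
  ring_nf
  positivity

lemma ineqU {x g : ℝ} (hx : 0 < x) (hg : 1 ≤ g) :
    sinh x * (3 * (cosh x ^ 2 + 2 * g * cosh x + 1)) ≤
      x * (cosh x ^ 3 + 4 * g * cosh x ^ 2 + 5 * cosh x + 2 * g) := by
  have h := low12 x hx
  have hs := s_pos hx
  obtain ⟨u, hu, hc⟩ := exu x
  obtain ⟨v, hv, rfl⟩ := exv hg
  rw [hc] at h ⊢
  simp only [add_sub_cancel_left] at h
  refine lower_use h (by positivity) (by positivity) hs ?_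
  ring_nf
  positivity

lemma ineqn {x g : ℝ} (hx : 0 < x) (hg : 1 ≤ g) :
    sinh x * (2 * (g + cosh x)) ≤
      x * (cosh x ^ 2 + 2 * g * cosh x + 1) := by
  have h := low12 x hx
  have hs := s_pos hx
  obtain ⟨u, hu, hc⟩ := exu x
  obtain ⟨v, hv, rfl⟩ := exv hg
  rw [hc] at h ⊢
  simp only [add_sub_cancel_left] at h
  refine lower_use h (by positivity) (by positivity) hs ?_
  ring_nf
  positivity

lemma ineqn2 {x g : ℝ} (hx : 0 < x) (hg : 1 ≤ g) (hg2 : g ≤ 11/4) :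
    x * (2 * (g * cosh x ^ 2 + 2 * cosh x + g)) ≤ sinh x * (cosh x ^ 2 + 4 * g * cosh x + 3) := by
  have h := up11 x hx
  have hs := s_pos hx
  obtain ⟨u, hu, hc⟩ := exu x
  obtain ⟨v, hv, rfl⟩ := exv hg
  rw [hc] at h ⊢
  simp only [add_sub_cancel_left] at h
  refine upper_use h (by positivity) (by positivity) hs ?_
  have e : (( 1 + u) ^ 2 + 4 * (1 + v) * (1 + u) + 3) * (15 + 6 * u) - 2 * ((1 + v) * (1 + u) ^ 2 + 2 * (1 + u) + (1 + v)) * (15 + u)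
    = u * ((1 - 4/7 * v) * (10 + 13 * u + 4 * u^2) + (4/7*v) * (45 - 9/2*u + 1/2*u^2)) := by ring
  rw [e]
  have h1 : 0 ≤ 1 - 4/7 * v := by linarith
  have h2 : 0 ≤ 45 - 9/2*u + 1/2*u^2 := by nlinarith [sq_nonneg (u - 9/2)]
  positivity

lemma ineqV {x g : ℝ} (hx : 0 < x) (hg : 1 ≤ g) (hg2 : g ≤ 11/4) :
    x * (4 * g * cosh x ^ 3 + 13 * cosh x ^ 2 + 14 * g * cosh x + 5) ≤
      sinh x * (cosh x ^ 3 + 10 * g * cosh x ^ 2 + 17 * cosh x + 8 * g) := by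
  have h := up22 x hx
  have hs := s_pos hx
  obtain ⟨u, hu, hc⟩ := exu x
  obtain ⟨v, hv, rfl⟩ := exv hg
  rw [hc] at h ⊢
  simp only [add_sub_cancel_left] at h
  refine upper_use h (by positivity) (by positivity) hs ?_
  have e : ((1 + u) ^ 3 + 10 * (1 + v) * (1 + u) ^ 2 + 17 * (1 + u) + 8 * (1 + v)) * (315 + 210 * u + 30 * u ^ 2) - (4 * (1 + v) * (1 + u) ^ 3 + 13 * (1 + u) ^ 2 + 14 * (1 + v) * (1 + u) + 5) * (315 + 105 * u + 2 * u ^ 2)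
    = u^2 * ((1 - 4/7 * v) * (168 + 256 * u + 130 * u^2 + 22 * u^3) + (4/7*v) * (2520 + 480 * u - 122 * u^2 + 8 * u^3)) := by ring
  rw [e]
  have h1 : 0 ≤ 1 - 4/7 * v := by linarith
  have h2 : 0 ≤ 2520 + 480 * u - 122 * u^2 + 8 * u^3 := by
    nlinarith [mul_nonneg hu (sq_nonneg (u - 15/2)), sq_nonneg (u - 15/2)]
  positivity

lemma ineq3 {x g : ℝ} (hx : 0 < x) (hg : 1 ≤ g) (hg2 : g ≤ 11/4) :
    0 ≤ x^2 * (g * cosh x ^ 4 + 4 * g^2 * cosh x ^ 3 + 6 * g * cosh x ^ 2 + 4 * cosh x + g)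
      - x * sinh x * (3 * g * cosh x ^ 3 + (6 * g^2 + 2) * cosh x ^ 2 + 7 * g * cosh x + 3 - g^2)
      + sinh x ^ 2 * ((g + cosh x) * (g * cosh x + 1)) := by
  have h := low12 x hx
  have hs := s_pos hx
  obtain ⟨u, hu, hc⟩ := exu x
  obtain ⟨v, hv, rfl⟩ := exv hg
  rw [hc] at h ⊢
  simp only [add_sub_cancel_left] at h
  have hv2 : v ≤ 7/4 := by linarith
  obtain ⟨v', hv', e'⟩ : ∃ v', 0 ≤ v' ∧ v + v' = 7/4 := ⟨7/4 - v, by linarith, by ring⟩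
  generalize sinh x = s at *
  set D := 105 + 60 * u + 6 * u^2 with hD
  set N := 105 + 25 * u with hN
  set A := ((1 + v) * (1 + u) ^ 4 + 4 * (1 + v)^2 * (1 + u) ^ 3 + 6 * (1 + v) * (1 + u) ^ 2 + 4 * (1 + u) + (1 + v)) with hA
  set B := (3 * (1 + v) * (1 + u) ^ 3 + (6 * (1 + v)^2 + 2) * (1 + u) ^ 2 + 7 * (1 + v) * (1 + u) + 3 - (1 + v)^2) with hB
  set C := ((1 + v + (1 + u)) * ((1 + v) * (1 + u) + 1)) with hC
  have hDp : 0 < D := by positivity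
  have hAp : 0 < A := by positivity
  have k1 : 0 ≤ A * N^2 - B * N * D + C * D^2 := by
    rw [hA, hB, hC, hD, hN]; ring_nf; positivity
  have k2 : 0 ≤ 2 * A * N - B * D := by
    rw [hA, hB, hD, hN]; ring_nf; positivity
  have e : (x^2 * A - x * s * B + s^2 * C) * D^2 =
     (x * D - s * N) * (A * (x * D - s * N) + s * (2 * A * N - B * D)) + s^2 * (A * N^2 - B * N * D + C * D^2) := by ring
  have : 0 ≤ (x^2 * A - x * s * B + s^2 * C) * D^2 := by
    rw [e]
    have : 0 ≤ x * D - s * N := by linarith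
    positivity
  exact nonneg_of_mul_nonneg_left this (by positivity)

lemma ineqY {x g : ℝ} (hx : 0 < x) (hg : 1 ≤ g) (hg2 : g ≤ 11/4) :
    x^2 * (cosh x ^ 2 + 2 * g * cosh x + 1) ≤ sinh x ^ 2 * (g * cosh x + 1)
      + x * sinh x * (g + cosh x) := by
  have hs := s_pos hx
  by_cases hc45 : cosh x ≤ 45
  · have h := up22 x hx
    obtain ⟨u, hu, hc⟩ := exu x
    obtain ⟨v, hv, rfl⟩ := exv hg
    rw [hc] at h ⊢
    have hu2 : u ≤ 44 := by linarith
    obtain ⟨u', hu', e'⟩ : ∃ u', 0 ≤ u' ∧ u' = 44 - u := ⟨44 - u, by linarith, by ring⟩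
    simp only [add_sub_cancel_left] at h
    generalize sinh x = s at *
    set D := 315 + 210 * u + 30 * u^2 with hD
    set N := 315 + 105 * u + 2 * u^2 with hN
    set A := ((1 + u) ^ 2 + 2 * (1 + v) * (1 + u) + 1) with hA
    set B := (1 + v + (1 + u)) with hB
    set C := (1 + v) * (1 + u) + 1 with hC
    have hDp : 0 < D := by positivity
    have hNp : 0 < N := by positivity
    have hAp : 0 < A := by positivity
    have hBp : 0 < B := by positivity
    have hCp : 0 < C := by positivity
    have k1 : 0 ≤ C * D^2 + B * N * D - A * N^2 := by
      have : C * D^2 + B * N * D - A * N^2 = u^2 * (8820 + 10500 * u + 4109 * u^2 + 348 * u^3 + 4 * u^3 * u'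
          + v * (70560 + 53760 * u + 12712 * u^2 + 892 * u^3)) := by
        rw [hA, hB, hC, hD, hN, e']; ring_nf
      rw [this]; positivity
    -- concave quadratic in t = x / s, positive at 0 and at N / D
    have e : (s^2 * C + x * s * B - x^2 * A) * (D * N) =
       (s * N - x * D) * (s * C * D + x * A * N) * 1 + x * s * (C * D^2 + B * N * D - A * N^2) := by ring
    have : 0 ≤ (s^2 * C + x * s * B - x^2 * A) * (D * N) := by
      rw [e]
      have : 0 ≤ s * N - x * D := by linarith
      positivity
    have := nonneg_of_mul_nonneg_left this (by positivity)
    linarith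
  · push Not at hc45
    have h := up11 (x/2) (by positivity)
    have hs2 := s_pos (half_pos hx)
    have hcc : cosh x = 2 * cosh (x/2)^2 - 1 := by
      have := Real.cosh_two_mul (x/2)
      rw [show 2 * (x/2) = x by ring] at this
      have := s_sq (x/2); linarith
    have hC : 4.75 ≤ cosh (x/2) := by
      have := one_le_c (x/2)
      nlinarith
    have h2 : x ≤ sinh (x/2) := by
      have : x/2 * (15 + 6 * (cosh (x/2) - 1)) ≤ sinh (x/2) * (1/2) * (15 + 6 * (cosh (x/2) - 1)) := by
        nlinarith
      have := le_of_mul_le_mul_right this (by linarith)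
      linarith
    have h3 : x^2 ≤ (cosh x - 1)/2 := by
      have := s_sq (x/2)
      nlinarith
    have e1 := s_sq x
    have : 0 ≤ x * sinh x * (g + cosh x) := by positivity
    have h4 : cosh x ^ 2 + 2 * g * cosh x + 1 ≤ g * (cosh x + 1)^2 := by nlinarith
    have h5 : x^2 * (cosh x ^ 2 + 2 * g * cosh x + 1) ≤ (cosh x - 1)/2 * (g * (cosh x + 1)^2) := by
      apply mul_le_mul h3 h4 (by positivity) (by linarith)
    have h6 : (cosh x - 1)/2 * (g * (cosh x + 1)^2) ≤ sinh x ^ 2 * (g * cosh x + 1) := by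
      rw [e1]
      have : 0 ≤ (cosh x - 1) * (cosh x + 1) * (g * cosh x + 1 - g * (cosh x + 1) / 2) := by
        apply mul_nonneg
        · apply mul_nonneg <;> linarith
        · nlinarith
      nlinarith
    linarith


noncomputable def hh (g x : ℝ) : ℝ := (g * cosh x + 1) / sinh x
noncomputable def ll (g x : ℝ) : ℝ := (g + cosh x) / sinh x ^ 2
noncomputable def l1 (g x : ℝ) : ℝ := -(cosh x ^ 2 + 2 * g * cosh x + 1) / sinh x ^ 3
noncomputable def l2 (g x : ℝ) : ℝ := (cosh x ^ 3 + 4 * g * cosh x ^ 2 + 5 * cosh x + 2 * g) / sinh x ^ 4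

lemma hh_deriv (g : ℝ) {x : ℝ} (hx : 0 < x) : HasDerivAt (hh g) (-ll g x) x := by
  have hs := (s_pos hx).ne'
  have := (((hasDerivAt_cosh x).const_mul g).add_const 1).div (hasDerivAt_sinh x) hs
  refine this.congr_deriv ?_
  unfold ll
  field_simp
  linear_combination g * s_sq x

lemma ll_deriv (g : ℝ) {x : ℝ} (hx : 0 < x) : HasDerivAt (ll g) (l1 g x) x := by
  have hs := (s_pos hx).ne'
  have := ((hasDerivAt_cosh x).const_add g).div ((hasDerivAt_sinh x).pow 2) (pow_ne_zero 2 hs)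
  refine this.congr_deriv ?_
  unfold l1
  simp only [Pi.pow_apply]
  field_simp
  push_cast
  linear_combination sinh x * s_sq x

lemma l1_deriv (g : ℝ) {x : ℝ} (hx : 0 < x) : HasDerivAt (l1 g) (l2 g x) x := by
  have hs := (s_pos hx).ne'
  have := (((((hasDerivAt_cosh x).pow 2).add ((hasDerivAt_cosh x).const_mul (2 * g))).add_const 1).neg).div ((hasDerivAt_sinh x).pow 3) (pow_ne_zero 3 hs)
  refine this.congr_deriv ?_
  unfold l2
  simp only [Pi.pow_apply, Pi.neg_apply, Pi.add_apply]
  field_simp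
  push_cast
  linear_combination (-2 * cosh x - 2 * g) * sinh x ^ 2 * s_sq x

lemma hh_pos {g x : ℝ} (hx : 0 < x) (hg : 1 ≤ g) : 0 < hh g x := by
  have := s_pos hx; have := one_le_c x; unfold hh; positivity

lemma ll_pos {g x : ℝ} (hx : 0 < x) (hg : 1 ≤ g) : 0 < ll g x := by
  have := s_pos hx; have := one_le_c x; unfold ll; positivity

lemma l1_neg {g x : ℝ} (hx : 0 < x) (hg : 1 ≤ g) : l1 g x < 0 := by
  have := s_pos hx; have := one_le_c x; unfold l1; rw [neg_div, neg_lt_zero]; positivity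

lemma psi_mono {g : ℝ} (hg : 1 ≤ g) :
    MonotoneOn (fun x => sinh x ^ 2 / ((g * cosh x + 1) * (g + cosh x))) (Ioi 0) := by
  refine mono_of_deriv (f' := fun x => sinh x * ((1 + g^2) * cosh x ^ 2 + 4 * g * cosh x + (1 + g^2))
    / ((g * cosh x + 1) * (g + cosh x))^2) ?_ ?_
  · intro x hx
    have := one_le_c x
    have hd : (g * cosh x + 1) * (g + cosh x) ≠ 0 := by positivity
    have := ((hasDerivAt_sinh x).pow 2).div ((((hasDerivAt_cosh x).const_mul g).add_const 1).mul ((hasDerivAt_cosh x).const_add g)) hd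
    refine this.congr_deriv ?_
    simp only [Pi.pow_apply, Pi.mul_apply]
    congr 1
    push_cast
    linear_combination (-sinh x * (2 * g * cosh x + 1 + g^2)) * s_sq x
  · intro x hx
    have := s_pos hx; have := one_le_c x; positivity

lemma n_mono {g : ℝ} (hg : 1 ≤ g) (hg2 : g ≤ 11/4) :
    MonotoneOn (fun x => (x * (cosh x ^ 2 + 2 * g * cosh x + 1) - 2 * sinh x * (g + cosh x)) / sinh x ^ 2) (Ioi 0) := by
  refine mono_of_deriv (f' := fun x => (sinh x * (cosh x ^ 2 + 4 * g * cosh x + 3) - x * (2 * (g * cosh x ^ 2 + 2 * cosh x + g))) / sinh x ^ 3) ?_ ?_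
  · intro x hx
    have hs := (s_pos hx).ne'
    have hc := hasDerivAt_cosh x
    have := (((hasDerivAt_id x).mul (((hc.pow 2).add (hc.const_mul (2 * g))).add_const 1)).sub
      (((hasDerivAt_sinh x).const_mul 2).mul (hc.const_add g))).div ((hasDerivAt_sinh x).pow 2) (pow_ne_zero 2 hs)
    refine this.congr_deriv ?_
    simp only [Pi.pow_apply, Pi.mul_apply, Pi.sub_apply, Pi.add_apply, id]
    field_simp
    push_cast
    ring_nf
    have e3 : sinh x ^ 3 = sinh x * (cosh x ^ 2 - 1) := by rw [← s_sq]; ring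
    have e4 : sinh x ^ 4 = (cosh x ^ 2 - 1) ^ 2 := by rw [← s_sq]; ring
    have e5 : sinh x ^ 5 = sinh x * (cosh x ^ 2 - 1) ^ 2 := by rw [← s_sq]; ring
    simp only [e3, e4, e5, s_sq]
    ring
  · intro x hx
    have := s_pos hx
    have := ineqn2 hx hg hg2
    apply div_nonneg (by linarith) (by positivity)

lemma U_mono {g : ℝ} (hg : 1 ≤ g) (hg2 : g ≤ 11/4) :
    MonotoneOn (fun x => (x * (cosh x ^ 3 + 4 * g * cosh x ^ 2 + 5 * cosh x + 2 * g) - 3 * sinh x * (cosh x ^ 2 + 2 * g * cosh x + 1)) / sinh x ^ 3) (Ioi 0) := by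
  refine mono_of_deriv (f' := fun x => (sinh x * (cosh x ^ 3 + 10 * g * cosh x ^ 2 + 17 * cosh x + 8 * g) - x * (4 * g * cosh x ^ 3 + 13 * cosh x ^ 2 + 14 * g * cosh x + 5)) / sinh x ^ 4) ?_ ?_
  · intro x hx
    have hs := (s_pos hx).ne'
    have hc := hasDerivAt_cosh x
    have := (((hasDerivAt_id x).mul ((((hc.pow 3).add ((hc.pow 2).const_mul (4 * g))).add (hc.const_mul 5)).add_const (2 * g))).sub
      (((hasDerivAt_sinh x).const_mul 3).mul (((hc.pow 2).add (hc.const_mul (2 * g))).add_const 1))).div ((hasDerivAt_sinh x).pow 3) (pow_ne_zero 3 hs)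
    refine this.congr_deriv ?_
    simp only [Pi.pow_apply, Pi.mul_apply, Pi.sub_apply, Pi.add_apply, id]
    field_simp
    push_cast
    ring_nf
    have e3 : sinh x ^ 3 = sinh x * (cosh x ^ 2 - 1) := by rw [← s_sq]; ring
    have e4 : sinh x ^ 4 = (cosh x ^ 2 - 1) ^ 2 := by rw [← s_sq]; ring
    have e5 : sinh x ^ 5 = sinh x * (cosh x ^ 2 - 1) ^ 2 := by rw [← s_sq]; ring
    simp only [e3, e4, e5, s_sq]
    ring
  · intro x hx
    have := s_pos hx
    have := ineqV hx hg hg2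
    apply div_nonneg (by linarith) (by positivity)

lemma d_mono' {g : ℝ} (hg : 1 ≤ g) :
    MonotoneOn (fun x => sinh x ^ 3 / (x ^ 3 * ((g * cosh x + 1) * (g + cosh x)))) (Ioi 0) := by
  refine mono_of_deriv (f' := fun x => sinh x ^ 2 * (x * (g * cosh x ^ 3 + 2 * (1 + g^2) * cosh x ^ 2 + 5 * g * cosh x + (1 + g^2)) - sinh x * (3 * (g * cosh x ^ 2 + (1 + g^2) * cosh x + g))) / (x ^ 4 * ((g * cosh x + 1) * (g + cosh x)) ^ 2)) ?_ ?_
  · intro x hx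
    have := one_le_c x
    have hs := (s_pos hx).ne'
    have hc := hasDerivAt_cosh x
    have hd : x ^ 3 * ((g * cosh x + 1) * (g + cosh x)) ≠ 0 := by positivity
    have h1 : (g * cosh x + 1) ≠ 0 := by positivity
    have h2 : (g + cosh x) ≠ 0 := by positivity
    have := ((hasDerivAt_sinh x).pow 3).div (((hasDerivAt_id x).pow 3).mul (((hc.const_mul g).add_const 1).mul (hc.const_add g))) hd
    refine this.congr_deriv ?_
    simp only [Pi.pow_apply, Pi.mul_apply, Pi.sub_apply, Pi.add_apply, id]
    rw [div_eq_div_iff (by positivity) (by positivity)]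
    push_cast
    linear_combination (-sinh x ^ 2 * x ^ 7 * ((g * cosh x + 1) * (g + cosh x)) ^ 2 * x ^ 0 * (2 * g * cosh x + 1 + g^2)) * s_sq x
  · intro x hx
    have := s_pos hx
    have := one_le_c x
    have := ineq1 hx hg
    apply div_nonneg (mul_nonneg (by positivity) (by linarith)) (by positivity)

lemma e_mono' {g : ℝ} (hg : 1 ≤ g) (hg2 : g ≤ 11/4) :
    MonotoneOn (fun x => x * (sinh x * (g + cosh x) - x * (cosh x ^ 2 + 2 * g * cosh x + 1)) / ((g * cosh x + 1) * sinh x ^ 2)) (Ioi 0) := by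
  refine mono_of_deriv (f' := fun x => (x^2 * (g * cosh x ^ 4 + 4 * g^2 * cosh x ^ 3 + 6 * g * cosh x ^ 2 + 4 * cosh x + g)
      - x * sinh x * (3 * g * cosh x ^ 3 + (6 * g^2 + 2) * cosh x ^ 2 + 7 * g * cosh x + 3 - g^2)
      + sinh x ^ 2 * ((g + cosh x) * (g * cosh x + 1))) / ((g * cosh x + 1) ^ 2 * sinh x ^ 3)) ?_ ?_
  · intro x hx
    have := one_le_c x
    have hs := (s_pos hx).ne'
    have hs' := (s_pos hx)
    have hc := hasDerivAt_cosh x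
    have hS := hasDerivAt_sinh x
    have h1 : (g * cosh x + 1) ≠ 0 := by positivity
    have hd : (g * cosh x + 1) * sinh x ^ 2 ≠ 0 := by positivity
    have := (((hasDerivAt_id x).mul ((hS.mul (hc.const_add g)).sub ((hasDerivAt_id x).mul (((hc.pow 2).add (hc.const_mul (2 * g))).add_const 1))))).div
      (((hc.const_mul g).add_const 1).mul (hS.pow 2)) hd
    refine this.congr_deriv ?_
    simp only [Pi.pow_apply, Pi.mul_apply, Pi.sub_apply, Pi.add_apply, id]
    rw [div_eq_div_iff (by positivity) (by positivity)]
    push_cast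
    have e3 : sinh x ^ 3 = sinh x * (cosh x ^ 2 - 1) := by rw [← s_sq]; ring
    have e4 : sinh x ^ 4 = (cosh x ^ 2 - 1) ^ 2 := by rw [← s_sq]; ring
    have e5 : sinh x ^ 5 = sinh x * (cosh x ^ 2 - 1) ^ 2 := by rw [← s_sq]; ring
    have e6 : sinh x ^ 6 = (cosh x ^ 2 - 1) ^ 3 := by rw [← s_sq]; ring
    have e7 : sinh x ^ 7 = sinh x * (cosh x ^ 2 - 1) ^ 3 := by rw [← s_sq]; ring
    ring_nf
    simp only [e3, e4, e5, e6, e7, s_sq]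
    ring
  · intro x hx
    have := s_pos hx
    have := one_le_c x
    apply div_nonneg (ineq3 hx hg hg2) (by positivity)

/-! the five conditions -/
lemma a_smono {g x y : ℝ} (hg : 1 ≤ g) (hx : 0 < x) (hxy : x < y) :
    x / (hh g x * ll g x) < y / (hh g y * ll g y) := by
  have hy := hx.trans hxy
  have e : ∀ x, 0 < x → x / (hh g x * ll g x) = x * sinh x * (sinh x ^ 2 / ((g * cosh x + 1) * (g + cosh x))) := by
    intro x hx
    have := (s_pos hx).ne'; have := one_le_c x
    have h1 : (g * cosh x + 1) ≠ 0 := by positivity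
    have h2 : (g + cosh x) ≠ 0 := by positivity
    unfold hh ll; field_simp
  rw [e x hx, e y hy]
  have h := psi_mono hg hx hy hxy.le
  have hsx := s_pos hx
  have hcx := one_le_c x
  have hss : sinh x < sinh y := Real.sinh_lt_sinh.2 hxy
  have p : 0 < sinh x ^ 2 / ((g * cosh x + 1) * (g + cosh x)) := by positivity
  refine mul_lt_mul ?_ h p (by positivity)
  exact mul_lt_mul hxy hss.le hsx hy.le

lemma b_mono {g x y : ℝ} (hg : 1 ≤ g) (hg2 : g ≤ 11/4) (hx : 0 < x) (hxy : x ≤ y) :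
    -(2 * ll g x + x * l1 g x) * x / (hh g x * ll g x) ≤ -(2 * ll g y + y * l1 g y) * y / (hh g y * ll g y) := by
  have hy := hx.trans_le hxy
  have e : ∀ x, 0 < x → -(2 * ll g x + x * l1 g x) * x / (hh g x * ll g x) = x * ((x * (cosh x ^ 2 + 2 * g * cosh x + 1) - 2 * sinh x * (g + cosh x)) / sinh x ^ 2) * (sinh x ^ 2 / ((g * cosh x + 1) * (g + cosh x))) := by
    intro x hx
    have := (s_pos hx).ne'; have := one_le_c x
    have h1 : (g * cosh x + 1) ≠ 0 := by positivity
    have h2 : (g + cosh x) ≠ 0 := by positivity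
    unfold hh ll l1; field_simp; ring
  rw [e x hx, e y hy]
  have h := psi_mono hg hx hy hxy
  have h' := n_mono hg hg2 hx hy hxy
  have hcx := one_le_c x
  have p : 0 ≤ sinh x ^ 2 / ((g * cosh x + 1) * (g + cosh x)) := by positivity
  have p2 : ∀ x, 0 < x → 0 ≤ (x * (cosh x ^ 2 + 2 * g * cosh x + 1) - 2 * sinh x * (g + cosh x)) / sinh x ^ 2 := by
    intro x hx; have := ineqn hx hg
    exact div_nonneg (by linarith) (by positivity)
  have p2x := p2 x hx
  have p2y := p2 y hy
  refine mul_le_mul ?_ h p (by positivity)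
  exact mul_le_mul hxy h' p2x hy.le

lemma c_mono {g x y : ℝ} (hg : 1 ≤ g) (hg2 : g ≤ 11/4) (hx : 0 < x) (hxy : x ≤ y) :
    (3 * l1 g x + x * l2 g x) / (hh g x * ll g x) ≤ (3 * l1 g y + y * l2 g y) / (hh g y * ll g y) := by
  have hy := hx.trans_le hxy
  have e : ∀ x, 0 < x → (3 * l1 g x + x * l2 g x) / (hh g x * ll g x) = ((x * (cosh x ^ 3 + 4 * g * cosh x ^ 2 + 5 * cosh x + 2 * g) - 3 * sinh x * (cosh x ^ 2 + 2 * g * cosh x + 1)) / sinh x ^ 3) * (sinh x ^ 2 / ((g * cosh x + 1) * (g + cosh x))) := by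
    intro x hx
    have := (s_pos hx).ne'; have := one_le_c x
    have h1 : (g * cosh x + 1) ≠ 0 := by positivity
    have h2 : (g + cosh x) ≠ 0 := by positivity
    unfold hh ll l1 l2; field_simp; ring
  rw [e x hx, e y hy]
  have h := psi_mono hg hx hy hxy
  have h' := U_mono hg hg2 hx hy hxy
  have hcx := one_le_c x
  have hsy := s_pos hy
  have p : 0 ≤ sinh x ^ 2 / ((g * cosh x + 1) * (g + cosh x)) := by positivity
  have := ineqU hy hg
  refine mul_le_mul h' h p ?_
  exact div_nonneg (by linarith) (by positivity)

lemma d_mono {g x y : ℝ} (hg : 1 ≤ g) (hx : 0 < x) (hxy : x ≤ y) :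
    1 / (x ^ 3 * (hh g x * ll g x)) ≤ 1 / (y ^ 3 * (hh g y * ll g y)) := by
  have hy := hx.trans_le hxy
  have e : ∀ x, 0 < x → 1 / (x ^ 3 * (hh g x * ll g x)) = sinh x ^ 3 / (x ^ 3 * ((g * cosh x + 1) * (g + cosh x))) := by
    intro x hx
    have := (s_pos hx).ne'; have := one_le_c x
    have h1 : (g * cosh x + 1) ≠ 0 := by positivity
    have h2 : (g + cosh x) ≠ 0 := by positivity
    unfold hh ll; field_simp
  rw [e x hx, e y hy]
  exact d_mono' hg hx hy hxy

lemma e_eq {g x : ℝ} (hg : 1 ≤ g) (hx : 0 < x) : x * (ll g x + x * l1 g x) / hh g x = x * (sinh x * (g + cosh x) - x * (cosh x ^ 2 + 2 * g * cosh x + 1)) / ((g * cosh x + 1) * sinh x ^ 2) := by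
  have := (s_pos hx).ne'; have := one_le_c x
  have h1 : (g * cosh x + 1) ≠ 0 := by positivity
  unfold hh ll l1; field_simp; ring

lemma e_mono {g x y : ℝ} (hg : 1 ≤ g) (hg2 : g ≤ 11/4) (hx : 0 < x) (hxy : x ≤ y) :
    x * (ll g x + x * l1 g x) / hh g x ≤ y * (ll g y + y * l1 g y) / hh g y := by
  have hy := hx.trans_le hxy
  rw [e_eq hg hx, e_eq hg hy]
  exact e_mono' hg hg2 hx hy hxy

lemma e_ge {g x : ℝ} (hg : 1 ≤ g) (hg2 : g ≤ 11/4) (hx : 0 < x) :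
    -1 ≤ x * (ll g x + x * l1 g x) / hh g x := by
  rw [e_eq hg hx]
  have := (s_pos hx); have := one_le_c x
  rw [le_div_iff₀ (by positivity)]
  have := ineqY hx hg hg2
  linarith

lemma L_nonneg {g x : ℝ} (hg : 1 ≤ g) (hx : 0 < x) : 2 * ll g x + x * l1 g x ≤ 0 := by
  have hs := s_pos hx
  have : 2 * ll g x + x * l1 g x = -(x * (cosh x ^ 2 + 2 * g * cosh x + 1) - 2 * sinh x * (g + cosh x)) / sinh x ^ 3 := by
    unfold ll l1; field_simp; ring
  rw [this, neg_div, neg_nonpos]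
  have := ineqn hx hg
  exact div_nonneg (by linarith) (by positivity)

lemma B_nonneg {g x : ℝ} (hg : 1 ≤ g) (hx : 0 < x) : 0 ≤ 3 * l1 g x + x * l2 g x := by
  have hs := s_pos hx
  have : 3 * l1 g x + x * l2 g x = (x * (cosh x ^ 3 + 4 * g * cosh x ^ 2 + 5 * cosh x + 2 * g) - 3 * sinh x * (cosh x ^ 2 + 2 * g * cosh x + 1)) / sinh x ^ 4 := by
    unfold l1 l2; field_simp; ring
  rw [this]
  have := ineqU hx hg
  exact div_nonneg (by linarith) (by positivity)

lemma hl_lim_bound {g x : ℝ} (hg : 1 ≤ g) (hx : 0 < x) :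
    0 ≤ hh g x - x * ll g x ∧ hh g x - x * ll g x ≤ g * sinh x := by
  have hs := s_pos hx
  have e : hh g x - x * ll g x = (sinh x * (g * cosh x + 1) - x * (g + cosh x)) / sinh x ^ 2 := by
    unfold hh ll; field_simp
  have hxs : x ≤ sinh x := (Real.self_le_sinh_iff).2 hx.le
  have h := low12 x hx
  have hc := one_le_c x
  have h3 : sinh x * 3 ≤ x * (cosh x + 2) := by
    obtain ⟨u, hu, hc⟩ := exu x
    rw [hc] at h ⊢
    simp only [add_sub_cancel_left] at h
    refine lower_use h (by positivity) (by positivity) hs ?_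
    ring_nf; positivity
  rw [e]
  constructor
  · apply div_nonneg _ (by positivity)
    nlinarith [mul_nonneg (sub_nonneg.2 hg) (sub_nonneg.2 hc)]
  · rw [div_le_iff₀ (by positivity), s_sq]
    have e2 : sinh x * (g * cosh x + 1) * 3 ≤ (sinh x * 3) * (g * cosh x + 1) := by linarith
    have h5 : (sinh x * 3) * (g + cosh x) ≤ x * (cosh x + 2) * (g + cosh x) :=
      mul_le_mul_of_nonneg_right h3 (by linarith)
    have key : 0 ≤ (cosh x + 2) * (g * (cosh x^2 - 1) - (g * cosh x + 1)) + 3 * (g + cosh x) := by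
      obtain ⟨u, hu, hc⟩ := exu x
      obtain ⟨v, hv, rfl⟩ := exv hg
      rw [hc]; ring_nf; positivity
    have k2 := mul_nonneg hs.le key
    have : 0 ≤ (cosh x + 2) * (g * sinh x * (cosh x ^ 2 - 1) - (sinh x * (g * cosh x + 1) - x * (g + cosh x))) := by nlinarith
    have := nonneg_of_mul_nonneg_right this (by linarith)
    linarith


lemma up_cross {f f' : ℝ → ℝ} {a b : ℝ} (hab : a < b)
    (hd : ∀ t ∈ Icc a b, HasDerivAt f (f' t) t) (ha : f a ≤ 0) (hb : 0 < f b) :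
    ∃ z ∈ Ico a b, f z = 0 ∧ 0 ≤ f' z := by
  have hcont : ContinuousOn f (Icc a b) := fun t ht => (hd t ht).continuousAt.continuousWithinAt
  have hcl : IsClosed (Icc a b ∩ f ⁻¹' Iic 0) := hcont.preimage_isClosed_of_isClosed isClosed_Icc isClosed_Iic
  have hcomp : IsCompact (Icc a b ∩ f ⁻¹' Iic 0) := isCompact_Icc.of_isClosed_subset hcl inter_subset_left
  obtain ⟨z, ⟨hz, hz0⟩, hmax⟩ := hcomp.exists_isGreatest ⟨a, left_mem_Icc.2 hab.le, ha⟩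
  have hz0 : f z ≤ 0 := hz0
  have hzb : z < b := by
    rcases lt_or_eq_of_le hz.2 with h | h
    · exact h
    · subst h; linarith
  have hpos : ∀ t ∈ Ioo z b, 0 < f t := by
    intro t ht
    by_contra hcon
    push Not at hcon
    have := hmax ⟨⟨hz.1.trans ht.1.le, ht.2.le⟩, hcon⟩
    linarith [ht.1]
  have hev : ∀ᶠ t in 𝓝[>] z, t ∈ Ioo z b := Ioo_mem_nhdsGT hzb
  have hfz : f z = 0 := by
    apply le_antisymm hz0
    have : Tendsto f (𝓝[>] z) (𝓝 (f z)) := (hd z hz).continuousAt.continuousWithinAt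
    exact ge_of_tendsto this (hev.mono fun t ht => (hpos t ht).le)
  refine ⟨z, ⟨hz.1, hzb⟩, hfz, ?_⟩
  have hsl : Tendsto (slope f z) (𝓝[>] z) (𝓝 (f' z)) :=
    (hasDerivAt_iff_tendsto_slope.1 (hd z hz)).mono_left (nhdsWithin_mono _ (fun t ht => ne_of_gt ht))
  refine ge_of_tendsto hsl (hev.mono fun t ht => ?_)
  rw [slope_def_field, hfz, sub_zero]
  exact div_nonneg (hpos t ht).le (by linarith [ht.1])

lemma down_cross {f f' : ℝ → ℝ} {a b : ℝ} (hab : a < b)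
    (hd : ∀ t ∈ Icc a b, HasDerivAt f (f' t) t) (ha : 0 ≤ f a) (hb : f b < 0) :
    ∃ z ∈ Ico a b, f z = 0 ∧ f' z ≤ 0 := by
  obtain ⟨z, hz, h1, h2⟩ := up_cross (f := fun t => - f t) (f' := fun t => - f' t) hab
    (fun t ht => (hd t ht).neg) (by linarith) (by linarith)
  exact ⟨z, hz, by linarith, by linarith⟩

lemma J_neg {J J' : ℝ → ℝ} {R : ℝ} (hd : ∀ t ∈ Ioo 0 R, HasDerivAt J (J' t) t)
    (h0 : Tendsto J (𝓝[>] 0) (𝓝 0)) (h1 : Tendsto J (𝓝[<] R) (𝓝 0)) {r : ℝ} (hr : r ∈ Ioo 0 R)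
    (hJ : J r < 0) : (∃ t ∈ Ioo 0 r, J' t < 0) ∧ (∃ t ∈ Ioo r R, 0 < J' t) := by
  constructor
  · have e1 : ∀ᶠ t in 𝓝[>] (0:ℝ), J r < J t := h0.eventually (lt_mem_nhds hJ)
    obtain ⟨t, ht1, ht2⟩ := (e1.and (Ioo_mem_nhdsGT hr.1)).exists
    obtain ⟨c, hc, hc'⟩ := exists_hasDerivAt_eq_slope J J' ht2.2
      (fun x hx => (hd x ⟨ht2.1.trans_le hx.1, hx.2.trans_lt hr.2⟩).continuousAt.continuousWithinAt)
      (fun x hx => hd x ⟨ht2.1.trans hx.1, hx.2.trans hr.2⟩)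
    refine ⟨c, ⟨ht2.1.trans hc.1, hc.2⟩, ?_⟩
    rw [hc']
    exact div_neg_of_neg_of_pos (by linarith) (by linarith [ht2.2])
  · have e1 : ∀ᶠ t in 𝓝[<] R, J r < J t := h1.eventually (lt_mem_nhds hJ)
    obtain ⟨t, ht1, ht2⟩ := (e1.and (Ioo_mem_nhdsLT hr.2)).exists
    obtain ⟨c, hc, hc'⟩ := exists_hasDerivAt_eq_slope J J' ht2.1
      (fun x hx => (hd x ⟨hr.1.trans_le hx.1, hx.2.trans_lt ht2.2⟩).continuousAt.continuousWithinAt)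
      (fun x hx => hd x ⟨hr.1.trans hx.1, hx.2.trans ht2.2⟩)
    refine ⟨c, ⟨hc.1, hc.2.trans ht2.2⟩, ?_⟩
    rw [hc']
    exact div_pos (by linarith) (by linarith [ht2.1])

lemma J_pos {J J' : ℝ → ℝ} {R : ℝ} (hd : ∀ t ∈ Ioo 0 R, HasDerivAt J (J' t) t)
    (h0 : Tendsto J (𝓝[>] 0) (𝓝 0)) (h1 : Tendsto J (𝓝[<] R) (𝓝 0)) {r : ℝ} (hr : r ∈ Ioo 0 R)
    (hJ : 0 < J r) : (∃ t ∈ Ioo 0 r, 0 < J' t) ∧ (∃ t ∈ Ioo r R, J' t < 0) := by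
  obtain ⟨⟨t, ht, h⟩, ⟨t', ht', h'⟩⟩ := J_neg (J := fun t => - J t) (J' := fun t => - J' t)
    (fun t ht => (hd t ht).neg) (by simpa using h0.neg) (by simpa using h1.neg) hr (by linarith)
  exact ⟨⟨t, ht, by linarith⟩, ⟨t', ht', by linarith⟩⟩

structure Pot (H Λ Λ1 Λ2 : ℝ → ℝ) : Prop where
  dH : ∀ r, 0 < r → HasDerivAt H (-Λ r) r
  dΛ : ∀ r, 0 < r → HasDerivAt Λ (Λ1 r) r
  dΛ1 : ∀ r, 0 < r → HasDerivAt Λ1 (Λ2 r) r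
  Hpos : ∀ r, 0 < r → 0 < H r
  Λpos : ∀ r, 0 < r → 0 < Λ r
  Λ1neg : ∀ r, 0 < r → Λ1 r < 0
  ma : ∀ r t, 0 < r → r < t → r / (H r * Λ r) < t / (H t * Λ t)
  mb : ∀ r t, 0 < r → r < t → -(2 * Λ r + r * Λ1 r) * r / (H r * Λ r) ≤ -(2 * Λ t + t * Λ1 t) * t / (H t * Λ t)
  mc : ∀ r t, 0 < r → r < t → (3 * Λ1 r + r * Λ2 r) / (H r * Λ r) ≤ (3 * Λ1 t + t * Λ2 t) / (H t * Λ t)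
  md : ∀ r t, 0 < r → r < t → 1 / (r ^ 3 * (H r * Λ r)) ≤ 1 / (t ^ 3 * (H t * Λ t))
  me : ∀ r t, 0 < r → r < t → r * (Λ r + r * Λ1 r) / H r ≤ t * (Λ t + t * Λ1 t) / H t
  me1 : ∀ r, 0 < r → -1 ≤ r * (Λ r + r * Λ1 r) / H r
  hL : ∀ r, 0 < r → 2 * Λ r + r * Λ1 r ≤ 0
  hB : ∀ r, 0 < r → 0 ≤ 3 * Λ1 r + r * Λ2 r
  lim : Tendsto (fun r => H r - r * Λ r) (𝓝[>] 0) (𝓝 0)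

section
variable {H Λ Λ1 Λ2 : ℝ → ℝ}

noncomputable def QQ (H Λ Λ1 Λ2 : ℝ → ℝ) (y δ r : ℝ) : ℝ :=
  (y ^ 2 - y ^ 4) / r ^ 4 + y ^ 2 * (H r * Λ r) / r + y * (3 * Λ1 r + r * Λ2 r) / r
    + (Λ r - δ) * (Λ r - δ + r * Λ1 r)

noncomputable def PP (H Λ Λ1 : ℝ → ℝ) (y δ lam1 r : ℝ) : ℝ :=
  4 * y ^ 2 * lam1 - 2 * y * δ - 2 * y ^ 2 * (1 - y) / r ^ 2 + 2 * y ^ 2 * Λ r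
    + 2 * y * (Λ r + r * Λ1 r) + (y * (1 - y) / r + r * (Λ r - δ)) ^ 2 - y ^ 2 * H r ^ 2

lemma QQ_eq (h : Pot H Λ Λ1 Λ2) (y δ : ℝ) {r : ℝ} (hr : 0 < r) :
    QQ H Λ Λ1 Λ2 y δ r * (r / (H r * Λ r)) =
      (y ^ 2 - y ^ 4) * (1 / (r ^ 3 * (H r * Λ r))) + y ^ 2 + y * ((3 * Λ1 r + r * Λ2 r) / (H r * Λ r))
      + δ ^ 2 * (r / (H r * Λ r)) + δ * (-(2 * Λ r + r * Λ1 r) * r / (H r * Λ r))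
      + r * (Λ r + r * Λ1 r) / H r := by
  have h1 := (h.Hpos r hr).ne'
  have h2 := (h.Λpos r hr).ne'
  unfold QQ
  field_simp
  ring

lemma PP_deriv (h : Pot H Λ Λ1 Λ2) (y δ lam1 : ℝ) {r : ℝ} (hr : 0 < r) :
    HasDerivAt (PP H Λ Λ1 y δ lam1) (2 * r * QQ H Λ Λ1 Λ2 y δ r) r := by
  have i := hasDerivAt_id r
  have dH := h.dH r hr
  have dL := h.dΛ r hr
  have dL1 := h.dΛ1 r hr
  have := ((((((hasDerivAt_const r (4 * y ^ 2 * lam1 - 2 * y * δ)).sub ((hasDerivAt_const r (2 * y ^ 2 * (1 - y))).div (i.pow 2) (by simp; positivity))).add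
    (dL.const_mul (2 * y ^ 2))).add ((dL.add (i.mul dL1)).const_mul (2 * y))).add
    ((((hasDerivAt_const r (y * (1 - y))).div i hr.ne').add (i.mul (dL.sub_const δ))).pow 2)).sub ((dH.pow 2).const_mul (y ^ 2)))
  refine this.congr_deriv ?_
  unfold QQ
  simp only [Pi.pow_apply, Pi.mul_apply, Pi.sub_apply, Pi.add_apply, Pi.div_apply, id, Nat.cast_ofNat, Nat.add_one_sub_one, pow_one]
  have hr0 := hr.ne'
  field_simp
  ring

lemma QQ_pattern (h : Pot H Λ Λ1 Λ2) {y δ : ℝ} (hy : 0 < y) (hy1 : y ≤ 1) (hδ : 0 < δ) {r t : ℝ}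
    (hr : 0 < r) (hrt : r < t) (hQ : 0 ≤ QQ H Λ Λ1 Λ2 y δ r) : 0 < QQ H Λ Λ1 Λ2 y δ t := by
  have ht := hr.trans hrt
  have pr : 0 < r / (H r * Λ r) := div_pos hr (mul_pos (h.Hpos r hr) (h.Λpos r hr))
  have pt : 0 < t / (H t * Λ t) := div_pos ht (mul_pos (h.Hpos t ht) (h.Λpos t ht))
  have k : 0 ≤ QQ H Λ Λ1 Λ2 y δ r * (r / (H r * Λ r)) := mul_nonneg hQ pr.le
  rw [QQ_eq h y δ hr] at k
  have y4 : 0 ≤ y ^ 2 - y ^ 4 := by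
    have : y ^ 2 - y ^ 4 = y ^ 2 * ((1 - y) * (1 + y)) := by ring
    rw [this]; have : 0 ≤ 1 - y := by linarith
    positivity
  have a1 := mul_lt_mul_of_pos_left (h.ma r t hr hrt) (pow_pos hδ 2)
  have a2 := mul_le_mul_of_nonneg_left (h.mb r t hr hrt) hδ.le
  have a3 := mul_le_mul_of_nonneg_left (h.mc r t hr hrt) hy.le
  have a4 := mul_le_mul_of_nonneg_left (h.md r t hr hrt) y4
  have a5 := h.me r t hr hrt
  have : 0 < QQ H Λ Λ1 Λ2 y δ t * (t / (H t * Λ t)) := by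
    rw [QQ_eq h y δ ht]; linarith
  exact pos_of_mul_pos_left this pt.le

lemma QQ_one_pos (h : Pot H Λ Λ1 Λ2) {δ : ℝ} (hδ : 0 < δ) {r : ℝ}
    (hr : 0 < r) : 0 < QQ H Λ Λ1 Λ2 1 δ r := by
  have hp := mul_pos (h.Hpos r hr) (h.Λpos r hr)
  have pr : 0 < r / (H r * Λ r) := div_pos hr hp
  have : 0 < QQ H Λ Λ1 Λ2 1 δ r * (r / (H r * Λ r)) := by
    rw [QQ_eq h 1 δ hr]
    have a1 := mul_pos (pow_pos hδ 2) pr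
    have a2 : 0 ≤ δ * (-(2 * Λ r + r * Λ1 r) * r / (H r * Λ r)) := by
      have := h.hL r hr
      exact mul_nonneg hδ.le (div_nonneg (mul_nonneg (by linarith) hr.le) hp.le)
    have a3 : 0 ≤ (3 * Λ1 r + r * Λ2 r) / (H r * Λ r) := div_nonneg (h.hB r hr) hp.le
    have a5 := h.me1 r hr
    linarith
  exact pos_of_mul_pos_left this pr.le

lemma PP_pattern (h : Pot H Λ Λ1 Λ2) {y δ : ℝ} (hy : 0 < y) (hy1 : y ≤ 1) (hδ : 0 < δ) (lam1 : ℝ) {z1 z2 z3 : ℝ}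
    (h0 : 0 < z1) (h12 : z1 < z2) (h23 : z2 < z3) (p1 : PP H Λ Λ1 y δ lam1 z1 ≤ 0)
    (p2 : 0 ≤ PP H Λ Λ1 y δ lam1 z2) (p3 : PP H Λ Λ1 y δ lam1 z3 ≤ 0) : False := by
  have dd : ∀ r, 0 < r → HasDerivAt (PP H Λ Λ1 y δ lam1) (2 * r * QQ H Λ Λ1 Λ2 y δ r) r :=
    fun r hr => PP_deriv h y δ lam1 hr
  obtain ⟨c, hc, e⟩ := exists_hasDerivAt_eq_slope _ _ h12
    (fun x hx => (dd x (h0.trans_le hx.1)).continuousAt.continuousWithinAt)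
    (fun x hx => dd x (h0.trans hx.1))
  obtain ⟨c', hc', e'⟩ := exists_hasDerivAt_eq_slope _ _ h23
    (fun x hx => (dd x ((h0.trans h12).trans_le hx.1)).continuousAt.continuousWithinAt)
    (fun x hx => dd x ((h0.trans h12).trans hx.1))
  have hc0 : 0 < c := h0.trans hc.1
  have hc0' : 0 < c' := (h0.trans h12).trans hc'.1
  have q1 : 0 ≤ QQ H Λ Λ1 Λ2 y δ c := by
    have : 0 ≤ 2 * c * QQ H Λ Λ1 Λ2 y δ c := by
      rw [e]; exact div_nonneg (by linarith) (by linarith)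
    exact nonneg_of_mul_nonneg_right this (by linarith)
  have q2 := QQ_pattern h hy hy1 hδ hc0 (hc.2.trans hc'.1) q1
  have : 2 * c' * QQ H Λ Λ1 Λ2 y δ c' ≤ 0 := by
    rw [e']; exact div_nonpos_of_nonpos_of_nonneg (by linarith) (by linarith)
  have : 0 < 2 * c' * QQ H Λ Λ1 Λ2 y δ c' := by positivity
  linarith

lemma PP_one_lt (h : Pot H Λ Λ1 Λ2) {δ : ℝ} (hδ : 0 < δ) (lam1 : ℝ) {z1 z2 : ℝ}
    (h0 : 0 < z1) (h12 : z1 < z2) : PP H Λ Λ1 1 δ lam1 z1 < PP H Λ Λ1 1 δ lam1 z2 := by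
  have dd : ∀ r, 0 < r → HasDerivAt (PP H Λ Λ1 1 δ lam1) (2 * r * QQ H Λ Λ1 Λ2 1 δ r) r :=
    fun r hr => PP_deriv h 1 δ lam1 hr
  obtain ⟨c, hc, e⟩ := exists_hasDerivAt_eq_slope _ _ h12
    (fun x hx => (dd x (h0.trans_le hx.1)).continuousAt.continuousWithinAt)
    (fun x hx => dd x (h0.trans hx.1))
  have hc0 : 0 < c := h0.trans hc.1
  have := QQ_one_pos h hδ hc0
  have h2 : 0 < 2 * c * QQ H Λ Λ1 Λ2 1 δ c := by positivity
  rw [e] at h2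
  have := (div_pos_iff_of_pos_right (by linarith)).1 h2
  linarith

lemma Λ_lt (h : Pot H Λ Λ1 Λ2) {r t : ℝ} (hr : 0 < r) (hrt : r < t) : Λ t < Λ r := by
  obtain ⟨c, hc, e⟩ := exists_hasDerivAt_eq_slope Λ Λ1 hrt
    (fun x hx => (h.dΛ x (hr.trans_le hx.1)).continuousAt.continuousWithinAt)
    (fun x hx => h.dΛ x (hr.trans hx.1))
  have h2 := h.Λ1neg c (hr.trans hc.1)
  rw [e] at h2
  by_contra hcon
  push Not at hcon
  have : 0 ≤ (Λ t - Λ r) / (t - r) := div_nonneg (by linarith) (by linarith)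
  linarith
end


structure Sol (H Λ w g₁ g₁' g₂ g₂' : ℝ → ℝ) (R lam1 lam2 : ℝ) : Prop where
  hR : 0 < R
  dw : ∀ r, 0 < r → HasDerivAt w (H r * w r) r
  wpos : ∀ r, 0 < r → 0 < w r
  w0 : Tendsto w (𝓝[>] 0) (𝓝 0)
  d1 : ∀ r, 0 < r → HasDerivAt g₁ (g₁' r) r
  d1' : ∀ r, 0 < r → HasDerivAt g₁' (-(H r * g₁' r) - lam1 * g₁ r) r
  d2 : ∀ r, 0 < r → HasDerivAt g₂ (g₂' r) r
  d2' : ∀ r, 0 < r → HasDerivAt g₂' (-(H r * g₂' r) - (lam2 - Λ r) * g₂ r) r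
  p1 : ∀ r ∈ Ioo (0 : ℝ) R, 0 < g₁ r
  p2 : ∀ r ∈ Ioo (0 : ℝ) R, 0 < g₂ r
  z1 : g₁ R = 0
  z2 : g₂ R = 0
  t1 : Tendsto g₁ (𝓝[>] 0) (𝓝 1)
  t1' : Tendsto g₁' (𝓝[>] 0) (𝓝 0)
  t2 : Tendsto (fun r => g₂ r / r) (𝓝[>] 0) (𝓝 1)
  t2' : Tendsto g₂' (𝓝[>] 0) (𝓝 1)

section
variable {H Λ Λ1 Λ2 w g₁ g₁' g₂ g₂' : ℝ → ℝ} {R lam1 lam2 : ℝ}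

noncomputable def TT (H Λ g₁ g₁' : ℝ → ℝ) (δ y r : ℝ) : ℝ :=
  y * (1 - y) / r - y * (H r + 2 * g₁' r / g₁ r) + r * (Λ r - δ)

noncomputable def TD (H Λ Λ1 g₁ g₁' : ℝ → ℝ) (lam1 δ y r : ℝ) : ℝ :=
  - (y * (1 - y)) / r ^ 2 - y * (- Λ r + 2 * ((-(H r * g₁' r) - lam1 * g₁ r) * g₁ r - g₁' r ^ 2) / g₁ r ^ 2)
    + (Λ r - δ) + r * Λ1 r

noncomputable def JJ (w g₁ g₁' g₂ g₂' : ℝ → ℝ) (y r : ℝ) : ℝ :=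
  w r * (r ^ y * (g₂' r * g₁ r - g₂ r * g₁' r) - y * r ^ (y - 1) * (g₁ r * g₂ r))

lemma TT_deriv (h : Pot H Λ Λ1 Λ2) (s : Sol H Λ w g₁ g₁' g₂ g₂' R lam1 lam2) (δ y : ℝ) {r : ℝ}
    (hr : r ∈ Ioo 0 R) : HasDerivAt (TT H Λ g₁ g₁' δ y) (TD H Λ Λ1 g₁ g₁' lam1 δ y r) r := by
  have i := hasDerivAt_id r
  have hg := (s.p1 r hr).ne'
  have hr0 := hr.1.ne'
  have := (((hasDerivAt_const r (y * (1 - y))).div i hr0).sub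
    (((h.dH r hr.1).add (((s.d1' r hr.1).const_mul 2).div (s.d1 r hr.1) hg)).const_mul y)).add
    (i.mul ((h.dΛ r hr.1).sub_const δ))
  refine this.congr_deriv ?_
  unfold TD
  simp only [id]
  field_simp
  ring

lemma TD_eq (s : Sol H Λ w g₁ g₁' g₂ g₂' R lam1 lam2) (δ y : ℝ) {r : ℝ}
    (hr : r ∈ Ioo 0 R) : 2 * y * TD H Λ Λ1 g₁ g₁' lam1 δ y r =
      PP H Λ Λ1 y δ lam1 r + TT H Λ g₁ g₁' δ y r *
        (TT H Λ g₁ g₁' δ y r - 2 * (y * (1 - y)) / r - 2 * r * (Λ r - δ)) := by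
  have hg := (s.p1 r hr).ne'
  have hr0 := hr.1.ne'
  unfold TD PP TT
  field_simp
  ring

lemma JJ_deriv (s : Sol H Λ w g₁ g₁' g₂ g₂' R lam1 lam2) (y : ℝ) {r : ℝ}
    (hr : r ∈ Ioo 0 R) : HasDerivAt (JJ w g₁ g₁' g₂ g₂' y)
      (w r * r ^ (y - 1) * (g₁ r * g₂ r) * TT H Λ g₁ g₁' (lam2 - lam1) y r) r := by
  have i := hasDerivAt_id r
  have hg := (s.p1 r hr).ne'
  have hr0 := hr.1.ne'
  have e1 := s.d1 r hr.1
  have e1' := s.d1' r hr.1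
  have e2 := s.d2 r hr.1
  have e2' := s.d2' r hr.1
  have dy := Real.hasDerivAt_rpow_const (x := r) (p := y) (Or.inl hr0)
  have dy1 := Real.hasDerivAt_rpow_const (x := r) (p := y - 1) (Or.inl hr0)
  have := (s.dw r hr.1).mul ((dy.mul ((e2'.mul e1).sub (e2.mul e1'))).sub ((dy1.const_mul y).mul (e1.mul e2)))
  refine this.congr_deriv ?_
  have k1 : r ^ y = r ^ (y - 1) * r := by
    rw [Real.rpow_sub_one hr0]; field_simp
  have k2 : r ^ (y - 1 - 1) = r ^ (y - 1) / r := Real.rpow_sub_one hr0 _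
  simp only [Pi.sub_apply, Pi.mul_apply]
  rw [k2, k1]
  unfold TT
  generalize r ^ (y - 1) = q
  field_simp
  ring

lemma JJ_eq (s : Sol H Λ w g₁ g₁' g₂ g₂' R lam1 lam2) (y : ℝ) {r : ℝ}
    (hr : r ∈ Ioo 0 R) : JJ w g₁ g₁' g₂ g₂' y r = 
      w r * r ^ (y - 1) * (g₁ r * g₂ r) * (r * (g₂' r * g₁ r - g₂ r * g₁' r) / (g₁ r * g₂ r) - y) := by
  have hg := (s.p1 r hr).ne'
  have hg2 := (s.p2 r hr).ne'
  have hr0 := hr.1.ne'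
  have k1 : r ^ y = r ^ (y - 1) * r := by
    rw [Real.rpow_sub_one hr0]; field_simp
  unfold JJ
  rw [k1]
  field_simp

lemma fac_pos (s : Sol H Λ w g₁ g₁' g₂ g₂' R lam1 lam2) (y : ℝ) {r : ℝ}
    (hr : r ∈ Ioo 0 R) : 0 < w r * r ^ (y - 1) * (g₁ r * g₂ r) :=
  mul_pos (mul_pos (s.wpos r hr.1) (Real.rpow_pos_of_pos hr.1 _)) (mul_pos (s.p1 r hr) (s.p2 r hr))

lemma t2z (s : Sol H Λ w g₁ g₁' g₂ g₂' R lam1 lam2) : Tendsto g₂ (𝓝[>] 0) (𝓝 0) := by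
  have hid : Tendsto (fun r : ℝ => r) (𝓝[>] 0) (𝓝 0) := tendsto_id.mono_left nhdsWithin_le_nhds
  have := s.t2.mul hid
  rw [mul_zero] at this
  refine this.congr' ?_
  filter_upwards [self_mem_nhdsWithin] with r hr
  exact div_mul_cancel₀ _ (ne_of_gt hr)

lemma JJ_zero (s : Sol H Λ w g₁ g₁' g₂ g₂' R lam1 lam2) {y : ℝ} (hy : 0 ≤ y) :
    Tendsto (JJ w g₁ g₁' g₂ g₂' y) (𝓝[>] 0) (𝓝 0) := by
  have hp : Tendsto (fun r : ℝ => r ^ y) (𝓝[>] 0) (𝓝 (0 ^ y)) :=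
    ((Real.continuousAt_rpow_const 0 y (Or.inr hy)).tendsto).mono_left nhdsWithin_le_nhds
  have := (s.w0.mul hp).mul (((s.t2'.mul s.t1).sub ((t2z s).mul s.t1')).sub ((s.t2.mul s.t1).const_mul y))
  simp only [zero_mul] at this
  refine this.congr' ?_
  filter_upwards [self_mem_nhdsWithin] with r hr
  have hr0 : r ≠ 0 := ne_of_gt hr
  unfold JJ
  rw [Real.rpow_sub_one hr0]
  field_simp

lemma JJ_R (s : Sol H Λ w g₁ g₁' g₂ g₂' R lam1 lam2) (y : ℝ) :
    Tendsto (JJ w g₁ g₁' g₂ g₂' y) (𝓝[<] R) (𝓝 0) := by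
  have c : ContinuousAt (JJ w g₁ g₁' g₂ g₂' y) R := by
    have a1 := (s.d1 R s.hR).continuousAt
    have a2 := (s.d1' R s.hR).continuousAt
    have a3 := (s.d2 R s.hR).continuousAt
    have a4 := (s.d2' R s.hR).continuousAt
    have a5 := (s.dw R s.hR).continuousAt
    have a6 := Real.continuousAt_rpow_const R y (Or.inl s.hR.ne')
    have a7 := Real.continuousAt_rpow_const R (y - 1) (Or.inl s.hR.ne')
    exact a5.mul ((a6.mul ((a4.mul a1).sub (a3.mul a2))).sub ((a7.const_mul y).mul (a1.mul a3)))
  have e : JJ w g₁ g₁' g₂ g₂' y R = 0 := by simp [JJ, s.z1, s.z2]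
  have := c.tendsto
  rw [e] at this
  exact this.mono_left nhdsWithin_le_nhds

lemma neg_T (s : Sol H Λ w g₁ g₁' g₂ g₂' R lam1 lam2) {y : ℝ} (hy : 0 ≤ y) {r : ℝ} (hr : r ∈ Ioo 0 R)
    (hJ : JJ w g₁ g₁' g₂ g₂' y r < 0) :
    (∃ t ∈ Ioo 0 r, TT H Λ g₁ g₁' (lam2 - lam1) y t < 0) ∧
    (∃ t ∈ Ioo r R, 0 < TT H Λ g₁ g₁' (lam2 - lam1) y t) := by
  obtain ⟨⟨t, ht, h⟩, ⟨t', ht', h'⟩⟩ := J_neg (fun t ht => JJ_deriv s y ht) (JJ_zero s hy) (JJ_R s y) hr hJ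
  refine ⟨⟨t, ht, ?_⟩, ⟨t', ht', ?_⟩⟩
  · by_contra hc
    push Not at hc
    have := mul_nonneg (fac_pos s y (r := t) ⟨ht.1, ht.2.trans hr.2⟩).le hc
    linarith
  · exact pos_of_mul_pos_right h' (fac_pos s y (r := t') ⟨hr.1.trans ht'.1, ht'.2⟩).le

lemma pos_T (s : Sol H Λ w g₁ g₁' g₂ g₂' R lam1 lam2) {y : ℝ} (hy : 0 ≤ y) {r : ℝ} (hr : r ∈ Ioo 0 R)
    (hJ : 0 < JJ w g₁ g₁' g₂ g₂' y r) :
    (∃ t ∈ Ioo 0 r, 0 < TT H Λ g₁ g₁' (lam2 - lam1) y t) ∧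
    (∃ t ∈ Ioo r R, TT H Λ g₁ g₁' (lam2 - lam1) y t < 0) := by
  obtain ⟨⟨t, ht, h⟩, ⟨t', ht', h'⟩⟩ := J_pos (fun t ht => JJ_deriv s y ht) (JJ_zero s hy) (JJ_R s y) hr hJ
  refine ⟨⟨t, ht, ?_⟩, ⟨t', ht', ?_⟩⟩
  · exact pos_of_mul_pos_right h (fac_pos s y (r := t) ⟨ht.1, ht.2.trans hr.2⟩).le
  · by_contra hc
    push Not at hc
    have := mul_nonneg (fac_pos s y (r := t') ⟨hr.1.trans ht'.1, ht'.2⟩).le hc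
    linarith

lemma exists_star (s : Sol H Λ w g₁ g₁' g₂ g₂' R lam1 lam2) :
    ∃ r ∈ Ioo 0 R, Λ r = lam2 - lam1 := by
  obtain ⟨c, hc, e⟩ := exists_hasDerivAt_eq_zero' s.hR (JJ_zero s le_rfl) (JJ_R s 0)
    (fun t ht => JJ_deriv s 0 ht)
  refine ⟨c, hc, ?_⟩
  have f := fac_pos s 0 hc
  rcases mul_eq_zero.1 e with h | h
  · exact absurd h f.ne'
  · simp only [TT, sub_zero, zero_mul, zero_div, zero_add, zero_sub, neg_zero] at h
    rcases mul_eq_zero.1 h with h | h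
    · exact absurd h hc.1.ne'
    · linarith

lemma JJ_nonneg (h : Pot H Λ Λ1 Λ2) (s : Sol H Λ w g₁ g₁' g₂ g₂' R lam1 lam2) {r : ℝ} (hr : r ∈ Ioo 0 R) :
    0 ≤ JJ w g₁ g₁' g₂ g₂' 0 r := by
  by_contra hc
  push Not at hc
  obtain ⟨⟨t, ht, h1⟩, ⟨t', ht', h2⟩⟩ := neg_T s le_rfl hr hc
  simp only [TT, sub_zero, zero_mul, zero_div, zero_add] at h1 h2
  have l := Λ_lt h ht.1 (ht.2.trans ht'.1)
  have ht'0 : 0 < t' := hr.1.trans ht'.1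
  have q2 := pos_of_mul_pos_right h2 ht'0.le
  have : 0 < t * (Λ t - (lam2 - lam1)) := mul_pos ht.1 (by linarith)
  linarith

lemma s_lim (s : Sol H Λ w g₁ g₁' g₂ g₂' R lam1 lam2) : Tendsto (fun r => g₁' r / g₁ r) (𝓝[>] 0) (𝓝 0) := by
  have := s.t1'.div s.t1 one_ne_zero
  rw [zero_div] at this
  exact this

lemma rest_lim (h : Pot H Λ Λ1 Λ2) (s : Sol H Λ w g₁ g₁' g₂ g₂' R lam1 lam2) (y δ : ℝ) :
    Tendsto (fun r => - y * (H r - r * Λ r) - 2 * y * (g₁' r / g₁ r) - r * δ) (𝓝[>] 0) (𝓝 0) := by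
  have hid : Tendsto (fun r : ℝ => r) (𝓝[>] 0) (𝓝 0) := tendsto_id.mono_left nhdsWithin_le_nhds
  have := ((h.lim.const_mul (-y)).sub ((s_lim s).const_mul (2 * y))).sub (hid.mul_const δ)
  simpa using this

lemma TT_pos_near (h : Pot H Λ Λ1 Λ2) (s : Sol H Λ w g₁ g₁' g₂ g₂' R lam1 lam2) {y : ℝ} (δ : ℝ) (hy : 0 < y)
    (hy1 : y < 1) : ∀ᶠ r in 𝓝[>] (0:ℝ), 0 < TT H Λ g₁ g₁' δ y r := by
  have hpos : 0 < y * (1 - y) := mul_pos hy (by linarith)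
  filter_upwards [(rest_lim h s y δ).eventually (lt_mem_nhds (show -(y * (1 - y)) < 0 by linarith)),
    Ioo_mem_nhdsGT (zero_lt_one' ℝ)] with r hr hr1
  have e : TT H Λ g₁ g₁' δ y r = y * (1 - y) / r + (1 - y) * (r * Λ r) +
    (- y * (H r - r * Λ r) - 2 * y * (g₁' r / g₁ r) - r * δ) := by
    unfold TT; ring
  have a1 : y * (1 - y) ≤ y * (1 - y) / r := by
    rw [le_div_iff₀ hr1.1]
    nlinarith [hr1.2]
  have a2 : 0 < (1 - y) * (r * Λ r) := mul_pos (by linarith) (mul_pos hr1.1 (h.Λpos r hr1.1))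
  linarith

lemma no_rise (h : Pot H Λ Λ1 Λ2) (s : Sol H Λ w g₁ g₁' g₂ g₂' R lam1 lam2) {y : ℝ} (hy : 0 < y)
    (hy1 : y < 1) {r1 r2 : ℝ} (h1 : r1 ∈ Ioo 0 R) (h2 : r2 ∈ Ioo 0 R) (h12 : r1 < r2)
    (j1 : JJ w g₁ g₁' g₂ g₂' y r1 < 0) (j2 : 0 < JJ w g₁ g₁' g₂ g₂' y r2) : False := by
  obtain ⟨rs, hrs, es⟩ := exists_star s
  have hδ : 0 < lam2 - lam1 := by rw [← es]; exact h.Λpos rs hrs.1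
  obtain ⟨⟨ta, hta, Ta⟩, -⟩ := neg_T s hy.le h1 j1
  obtain ⟨-, ⟨tc, htc, Tc⟩⟩ := pos_T s hy.le h2 j2
  obtain ⟨tb, htb, Tb⟩ : ∃ t ∈ Ioo r1 r2, 0 < TT H Λ g₁ g₁' (lam2 - lam1) y t := by
    obtain ⟨c, hc, e⟩ := exists_hasDerivAt_eq_slope (JJ w g₁ g₁' g₂ g₂' y) _ h12
      (fun x hx => (JJ_deriv s y (r := x) ⟨h1.1.trans_le hx.1, hx.2.trans_lt h2.2⟩).continuousAt.continuousWithinAt)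
      (fun x hx => JJ_deriv s y (r := x) ⟨h1.1.trans hx.1, hx.2.trans h2.2⟩)
    refine ⟨c, hc, ?_⟩
    have : 0 < (JJ w g₁ g₁' g₂ g₂' y r2 - JJ w g₁ g₁' g₂ g₂' y r1) / (r2 - r1) :=
      div_pos (by linarith) (by linarith)
    rw [← e] at this
    exact pos_of_mul_pos_right this (fac_pos s y (r := c) ⟨h1.1.trans hc.1, hc.2.trans h2.2⟩).le
  obtain ⟨t0, Tt0, ht0⟩ := ((TT_pos_near h s (lam2 - lam1) hy hy1).and (Ioo_mem_nhdsGT hta.1)).exists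
  have htaR : ta < R := hta.2.trans h1.2
  have hab : ta < tb := hta.2.trans htb.1
  have hbc : tb < tc := htb.2.trans htc.1
  have hb0 : 0 < tb := hta.1.trans hab
  have key : ∀ z ∈ Ioo 0 R, TT H Λ g₁ g₁' (lam2 - lam1) y z = 0 →
      2 * y * TD H Λ Λ1 g₁ g₁' lam1 (lam2 - lam1) y z = PP H Λ Λ1 y (lam2 - lam1) lam1 z := by
    intro z hz e
    rw [TD_eq s _ _ hz, e]; ring
  obtain ⟨z1, hz1, e1, k1⟩ := down_cross ht0.2
    (fun t ht => TT_deriv h s (lam2 - lam1) y (r := t) ⟨ht0.1.trans_le ht.1, ht.2.trans_lt htaR⟩) Tt0.le Ta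
  obtain ⟨z2, hz2, e2, k2⟩ := up_cross hab
    (fun t ht => TT_deriv h s (lam2 - lam1) y (r := t) ⟨hta.1.trans_le ht.1, ht.2.trans_lt (hbc.trans htc.2)⟩) Ta.le Tb
  obtain ⟨z3, hz3, e3, k3⟩ := down_cross hbc
    (fun t ht => TT_deriv h s (lam2 - lam1) y (r := t) ⟨hb0.trans_le ht.1, ht.2.trans_lt htc.2⟩) Tb.le Tc
  have z10 : 0 < z1 := ht0.1.trans_le hz1.1
  have z12 : z1 < z2 := hz1.2.trans_le hz2.1
  have z23 : z2 < z3 := hz2.2.trans_le hz3.1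
  have z3R : z3 < R := hz3.2.trans htc.2
  refine PP_pattern h hy hy1.le hδ lam1 z10 z12 z23 ?_ ?_ ?_
  · rw [← key z1 ⟨z10, z12.trans (z23.trans z3R)⟩ e1]
    nlinarith
  · rw [← key z2 ⟨z10.trans z12, z23.trans z3R⟩ e2]
    positivity
  · rw [← key z3 ⟨z10.trans (z12.trans z23), z3R⟩ e3]
    nlinarith

lemma JJ_one (h : Pot H Λ Λ1 Λ2) (s : Sol H Λ w g₁ g₁' g₂ g₂' R lam1 lam2) {r : ℝ} (hr : r ∈ Ioo 0 R) :
    JJ w g₁ g₁' g₂ g₂' 1 r ≤ 0 := by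
  by_contra hc
  push Not at hc
  obtain ⟨rs, hrs, es⟩ := exists_star s
  have hδ : 0 < lam2 - lam1 := by rw [← es]; exact h.Λpos rs hrs.1
  obtain ⟨⟨ta, hta, Ta⟩, ⟨tb, htb, Tb⟩⟩ := pos_T s zero_le_one hr hc
  have hab : ta < tb := hta.2.trans htb.1
  have key : ∀ z ∈ Ioo 0 R, TT H Λ g₁ g₁' (lam2 - lam1) 1 z = 0 →
      2 * TD H Λ Λ1 g₁ g₁' lam1 (lam2 - lam1) 1 z = PP H Λ Λ1 1 (lam2 - lam1) lam1 z := by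
    intro z hz e
    have := TD_eq (Λ1 := Λ1) s (lam2 - lam1) 1 hz
    rw [e] at this; linarith
  obtain ⟨z, hz, ez, kz⟩ := down_cross hab
    (fun t ht => TT_deriv h s (lam2 - lam1) 1 (r := t) ⟨hta.1.trans_le ht.1, ht.2.trans_lt htb.2⟩) Ta.le Tb
  have hza : ta < z := by
    rcases lt_or_eq_of_le hz.1 with q | q
    · exact q
    · rw [← q] at ez; linarith
  have z0 : 0 < z := hta.1.trans hza
  have Pz : PP H Λ Λ1 1 (lam2 - lam1) lam1 z ≤ 0 := by
    rw [← key z ⟨z0, hz.2.trans htb.2⟩ ez]; linarith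
  have Pa : PP H Λ Λ1 1 (lam2 - lam1) lam1 ta < 0 := (PP_one_lt h hδ lam1 hta.1 hza).trans_le Pz
  have htaR : ta < R := hta.2.trans hr.2
  have Tpos : ∀ t ∈ Ioo 0 ta, 0 < TT H Λ g₁ g₁' (lam2 - lam1) 1 t := by
    intro t ht
    by_contra hcon
    push Not at hcon
    obtain ⟨x, hx, ex, kx⟩ := up_cross ht.2
      (fun u hu => TT_deriv h s (lam2 - lam1) 1 (r := u) ⟨ht.1.trans_le hu.1, hu.2.trans_lt htaR⟩) hcon Ta
    have x0 : 0 < x := ht.1.trans_le hx.1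
    have := key x ⟨x0, hx.2.trans htaR⟩ ex
    have := PP_one_lt h hδ lam1 x0 hx.2
    linarith
  have Tlim : Tendsto (TT H Λ g₁ g₁' (lam2 - lam1) 1) (𝓝[>] 0) (𝓝 0) := by
    refine (rest_lim h s 1 (lam2 - lam1)).congr fun r => ?_
    unfold TT; ring
  have T2 : ∀ᶠ t in 𝓝[>] (0:ℝ), TT H Λ g₁ g₁' (lam2 - lam1) 1 t ^ 2 < -PP H Λ Λ1 1 (lam2 - lam1) lam1 ta := by
    have := Tlim.pow 2
    rw [zero_pow two_ne_zero] at this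
    exact this.eventually (gt_mem_nhds (by linarith))
  obtain ⟨u, hu0, hu⟩ := mem_nhdsGT_iff_exists_Ioo_subset.1 T2
  have hu0 : 0 < u := hu0
  set m := min u (min ta rs) with hm
  have hm0 : 0 < m := lt_min hu0 (lt_min hta.1 hrs.1)
  have hmu : m ≤ u := min_le_left _ _
  have hma : m ≤ ta := (min_le_right _ _).trans (min_le_left _ _)
  have hms : m ≤ rs := (min_le_right _ _).trans (min_le_right _ _)
  have dneg : ∀ t ∈ Ioo 0 m, TD H Λ Λ1 g₁ g₁' lam1 (lam2 - lam1) 1 t < 0 := by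
    intro t ht
    have tR : t ∈ Ioo 0 R := ⟨ht.1, (ht.2.trans_le hma).trans htaR⟩
    have e := TD_eq (Λ1 := Λ1) s (lam2 - lam1) 1 tR
    have p := Tpos t ⟨ht.1, ht.2.trans_le hma⟩
    have q : TT H Λ g₁ g₁' (lam2 - lam1) 1 t ^ 2 < -PP H Λ Λ1 1 (lam2 - lam1) lam1 ta :=
      hu ⟨ht.1, ht.2.trans_le hmu⟩
    have l := Λ_lt h ht.1 (ht.2.trans_le hms)
    have P := PP_one_lt h hδ lam1 ht.1 (ht.2.trans_le hma)
    have k : 0 < TT H Λ g₁ g₁' (lam2 - lam1) 1 t * (2 * t * (Λ t - (lam2 - lam1))) :=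
      mul_pos p (mul_pos (by linarith [ht.1]) (by linarith))
    have : 2 * TD H Λ Λ1 g₁ g₁' lam1 (lam2 - lam1) 1 t = PP H Λ Λ1 1 (lam2 - lam1) lam1 t
      + TT H Λ g₁ g₁' (lam2 - lam1) 1 t ^ 2
      - TT H Λ g₁ g₁' (lam2 - lam1) 1 t * (2 * t * (Λ t - (lam2 - lam1))) := by
      have : (2:ℝ) * (1 * (1 - 1)) / t = 0 := by simp
      rw [this] at e
      linear_combination e
    linarith
  have hm2 : m / 2 ∈ Ioo 0 m := ⟨by linarith, by linarith⟩
  have pm := Tpos (m / 2) ⟨hm2.1, hm2.2.trans_le hma⟩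
  obtain ⟨t, Tt, ht⟩ := ((Tlim.eventually (gt_mem_nhds pm)).and (Ioo_mem_nhdsGT hm2.1)).exists
  obtain ⟨c, hc, e⟩ := exists_hasDerivAt_eq_slope (TT H Λ g₁ g₁' (lam2 - lam1) 1) _ ht.2
      (fun x hx => (TT_deriv h s (lam2 - lam1) 1 (r := x) ⟨ht.1.trans_le hx.1, by linarith [hx.2, hm2.2]⟩).continuousAt.continuousWithinAt)
      (fun x hx => TT_deriv h s (lam2 - lam1) 1 (r := x) ⟨ht.1.trans hx.1, by linarith [hx.2, hm2.2]⟩)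
  have := dneg c ⟨ht.1.trans hc.1, hc.2.trans hm2.2⟩
  rw [e] at this
  have k : 0 < (TT H Λ g₁ g₁' (lam2 - lam1) 1 (m / 2) - TT H Λ g₁ g₁' (lam2 - lam1) 1 t) / (m / 2 - t) :=
    div_pos (by linarith) (by linarith [ht.2])
  linarith

lemma core (h : Pot H Λ Λ1 Λ2) (s : Sol H Λ w g₁ g₁' g₂ g₂' R lam1 lam2) :
    ∃ q : ℝ → ℝ, (∀ r, q r = r * (g₂' r * g₁ r - g₂ r * g₁' r) / (g₁ r * g₂ r)) ∧
    (∀ r ∈ Ioo 0 R, 0 ≤ q r) ∧ (∀ r ∈ Ioo 0 R, q r ≤ 1) ∧ AntitoneOn q (Ioo 0 R) := by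
  refine ⟨fun r => r * (g₂' r * g₁ r - g₂ r * g₁' r) / (g₁ r * g₂ r), fun r => rfl, ?_⟩
  have q0 : ∀ r ∈ Ioo 0 R, 0 ≤ r * (g₂' r * g₁ r - g₂ r * g₁' r) / (g₁ r * g₂ r) := by
    intro r hr
    have := JJ_nonneg h s hr
    rw [JJ_eq s 0 hr] at this
    have := nonneg_of_mul_nonneg_right this (fac_pos s 0 hr)
    linarith
  have q1 : ∀ r ∈ Ioo 0 R, r * (g₂' r * g₁ r - g₂ r * g₁' r) / (g₁ r * g₂ r) ≤ 1 := by
    intro r hr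
    have := JJ_one h s hr
    rw [JJ_eq s 1 hr] at this
    by_contra hc
    push Not at hc
    have := mul_pos (fac_pos s 1 hr) (sub_pos.2 hc)
    linarith
  refine ⟨q0, q1, ?_⟩
  intro r1 h1 r2 h2 h12
  rcases eq_or_lt_of_le h12 with e | h12
  · rw [e]
  by_contra hc
  push Not at hc
  obtain ⟨y, y1, y2⟩ := exists_between hc
  have a := q0 r1 h1
  have b := q1 r2 h2
  refine no_rise h s (lt_of_le_of_lt a y1) (y2.trans_le b) h1 h2 h12 ?_ ?_
  · rw [JJ_eq s y h1]
    exact mul_neg_of_pos_of_neg (fac_pos s y h1) (by linarith)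
  · rw [JJ_eq s y h2]
    exact mul_pos (fac_pos s y h2) (by linarith)
end


lemma mkPot {g e : ℝ} (hg : 1 ≤ g) (hg2 : g ≤ 11/4) (he : 0 < e) :
    Pot (fun r => e * hh g (2 * r)) (fun r => 2 * e * ll g (2 * r)) (fun r => 4 * e * l1 g (2 * r))
      (fun r => 8 * e * l2 g (2 * r)) where
  dH := by
    intro r hr
    have hx : 0 < 2 * r := by linarith
    have := ((hh_deriv g hx).comp r ((hasDerivAt_id r).const_mul 2)).const_mul e
    exact this.congr_deriv (by ring)
  dΛ := by
    intro r hr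
    have hx : 0 < 2 * r := by linarith
    have := ((ll_deriv g hx).comp r ((hasDerivAt_id r).const_mul 2)).const_mul (2 * e)
    exact this.congr_deriv (by ring)
  dΛ1 := by
    intro r hr
    have hx : 0 < 2 * r := by linarith
    have := ((l1_deriv g hx).comp r ((hasDerivAt_id r).const_mul 2)).const_mul (4 * e)
    exact this.congr_deriv (by ring)
  Hpos := fun r hr => mul_pos he (hh_pos (by linarith) hg)
  Λpos := fun r hr => mul_pos (by linarith) (ll_pos (by linarith) hg)
  Λ1neg := fun r hr => mul_neg_of_pos_of_neg (by linarith) (l1_neg (by linarith) hg)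
  ma := by
    intro r t hr hrt
    have k := a_smono (x := 2 * r) (y := 2 * t) hg (by linarith) (by linarith)
    have E : ∀ r : ℝ, 0 < r → r / (e * hh g (2 * r) * (2 * e * ll g (2 * r))) =
        1 / (4 * e ^ 2) * (2 * r / (hh g (2 * r) * ll g (2 * r))) := by
      intro r hr
      have := (hh_pos (x := 2 * r) (by linarith) hg).ne'
      have := (ll_pos (x := 2 * r) (by linarith) hg).ne'
      field_simp
      try ring
    rw [E r hr, E t (hr.trans hrt)]
    exact mul_lt_mul_of_pos_left k (by positivity)
  mb := by
    intro r t hr hrt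
    have k := b_mono (x := 2 * r) (y := 2 * t) hg hg2 (by linarith) (by linarith)
    have E : ∀ r : ℝ, 0 < r → -(2 * (2 * e * ll g (2 * r)) + r * (4 * e * l1 g (2 * r))) * r / (e * hh g (2 * r) * (2 * e * ll g (2 * r))) =
        1 / (2 * e) * (-(2 * ll g (2 * r) + 2 * r * l1 g (2 * r)) * (2 * r) / (hh g (2 * r) * ll g (2 * r))) := by
      intro r hr
      have := (hh_pos (x := 2 * r) (by linarith) hg).ne'
      have := (ll_pos (x := 2 * r) (by linarith) hg).ne'
      field_simp
      try ring
    rw [E r hr, E t (hr.trans hrt)]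
    exact mul_le_mul_of_nonneg_left k (by positivity)
  mc := by
    intro r t hr hrt
    have k := c_mono (x := 2 * r) (y := 2 * t) hg hg2 (by linarith) (by linarith)
    have E : ∀ r : ℝ, 0 < r → (3 * (4 * e * l1 g (2 * r)) + r * (8 * e * l2 g (2 * r))) / (e * hh g (2 * r) * (2 * e * ll g (2 * r))) =
        2 / e * ((3 * l1 g (2 * r) + 2 * r * l2 g (2 * r)) / (hh g (2 * r) * ll g (2 * r))) := by
      intro r hr
      have := (hh_pos (x := 2 * r) (by linarith) hg).ne'
      have := (ll_pos (x := 2 * r) (by linarith) hg).ne'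
      field_simp
      try ring
    rw [E r hr, E t (hr.trans hrt)]
    exact mul_le_mul_of_nonneg_left k (by positivity)
  md := by
    intro r t hr hrt
    have k := d_mono (x := 2 * r) (y := 2 * t) hg (by linarith) (by linarith)
    have E : ∀ r : ℝ, 0 < r → 1 / (r ^ 3 * (e * hh g (2 * r) * (2 * e * ll g (2 * r)))) =
        4 / e ^ 2 * (1 / ((2 * r) ^ 3 * (hh g (2 * r) * ll g (2 * r)))) := by
      intro r hr
      have := (hh_pos (x := 2 * r) (by linarith) hg).ne'
      have := (ll_pos (x := 2 * r) (by linarith) hg).ne'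
      field_simp
      try ring
    rw [E r hr, E t (hr.trans hrt)]
    exact mul_le_mul_of_nonneg_left k (by positivity)
  me := by
    intro r t hr hrt
    have k := e_mono (x := 2 * r) (y := 2 * t) hg hg2 (by linarith) (by linarith)
    have E : ∀ r : ℝ, 0 < r → r * ((2 * e * ll g (2 * r)) + r * (4 * e * l1 g (2 * r))) / (e * hh g (2 * r)) =
        1 * (2 * r * (ll g (2 * r) + 2 * r * l1 g (2 * r)) / hh g (2 * r)) := by
      intro r hr
      have := (hh_pos (x := 2 * r) (by linarith) hg).ne'
      have := (ll_pos (x := 2 * r) (by linarith) hg).ne'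
      field_simp
      try ring
    rw [E r hr, E t (hr.trans hrt)]
    exact mul_le_mul_of_nonneg_left k (by positivity)
  me1 := by
    intro r hr
    have k := e_ge (x := 2 * r) hg hg2 (by linarith)
    have := (hh_pos (x := 2 * r) (by linarith) hg).ne'
    refine k.trans (le_of_eq ?_)
    field_simp
    try ring
  hL := by
    intro r hr
    have k := L_nonneg (x := 2 * r) hg (by linarith)
    nlinarith
  hB := by
    intro r hr
    have k := B_nonneg (x := 2 * r) hg (by linarith)
    nlinarith
  lim := by
    have hs : Tendsto (fun r : ℝ => e * (g * sinh (2 * r))) (𝓝[>] 0) (𝓝 0) := by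
      have : Continuous (fun r : ℝ => e * (g * sinh (2 * r))) := by fun_prop
      have := this.tendsto 0
      simp only [mul_zero, sinh_zero] at this
      exact this.mono_left nhdsWithin_le_nhds
    refine tendsto_of_tendsto_of_tendsto_of_le_of_le' tendsto_const_nhds hs ?_ ?_
    · filter_upwards [self_mem_nhdsWithin] with r hr
      have hr : 0 < r := hr
      have k := (hl_lim_bound (x := 2 * r) hg (by linarith)).1
      nlinarith
    · filter_upwards [self_mem_nhdsWithin] with r hr
      have hr : 0 < r := hr
      have k := (hl_lim_bound (x := 2 * r) hg (by linarith)).2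
      nlinarith


lemma H_id (a b : ℝ) (he : a - b ≠ 0) {r : ℝ} (hr : 0 < r) :
    a * (cosh r / sinh r) + b * tanh r = (a - b) * hh ((a + b) / (a - b)) (2 * r) := by
  have hs := (s_pos hr).ne'
  have hc := (cosh_pos r).ne'
  unfold hh
  rw [tanh_eq_sinh_div_cosh, sinh_two_mul, cosh_two_mul]
  field_simp
  have := s_sq r
  linear_combination (-(a - b)) * this
lemma L_id (a b : ℝ) (he : a - b ≠ 0) {r : ℝ} (hr : 0 < r) :
    a / sinh r ^ 2 - b / cosh r ^ 2 = 2 * (a - b) * ll ((a + b) / (a - b)) (2 * r) := by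
  have hs := (s_pos hr).ne'
  have hc := (cosh_pos r).ne'
  unfold ll
  rw [sinh_two_mul, cosh_two_mul]
  field_simp
  have := s_sq r
  linear_combination (-(a + b)) * this

lemma w_der (A B : ℕ) {r : ℝ} (hr : 0 < r) :
    HasDerivAt (fun r => sinh r ^ A * cosh r ^ B)
      ((A * (cosh r / sinh r) + B * tanh r) * (sinh r ^ A * cosh r ^ B)) r := by
  have hs := (s_pos hr).ne'
  have hc := (cosh_pos r).ne'
  have := ((hasDerivAt_sinh r).pow A).mul ((hasDerivAt_cosh r).pow B)
  refine this.congr_deriv ?_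
  have e : ∀ (x : ℝ) (n : ℕ), x ≠ 0 → (n : ℝ) * x ^ (n - 1) = n * x ^ n / x := by
    intro x n hx
    rcases n with _ | n
    · simp
    · simp only [Nat.add_one_sub_one, pow_succ]; field_simp
  simp only [Pi.pow_apply]
  rw [e _ A hs, e _ B hc, tanh_eq_sinh_div_cosh]
  field_simp

lemma w_zero {A : ℕ} (hA : A ≠ 0) (B : ℕ) :
    Tendsto (fun r : ℝ => sinh r ^ A * cosh r ^ B) (𝓝[>] 0) (𝓝 0) := by
  have : Continuous (fun r : ℝ => sinh r ^ A * cosh r ^ B) := by fun_prop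
  have := this.tendsto 0
  simp only [sinh_zero, zero_pow hA, zero_mul] at this
  exact this.mono_left nhdsWithin_le_nhds


lemma final {H Λ Λ1 Λ2 w g₁ g₁' g₂ g₂' : ℝ → ℝ} {R lam1 lam2 : ℝ}
    (h : Pot H Λ Λ1 Λ2) (s : Sol H Λ w g₁ g₁' g₂ g₂' R lam1 lam2) :
    ∀ r ∈ Set.Ioo (0 : ℝ) R,
      0 ≤ r * deriv (fun s => g₂ s / g₁ s) r / (g₂ r / g₁ r) ∧
      r * deriv (fun s => g₂ s / g₁ s) r / (g₂ r / g₁ r) ≤ 1 ∧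
      deriv (fun s => s * deriv (fun t => g₂ t / g₁ t) s / (g₂ s / g₁ s)) r ≤ 0 := by
  obtain ⟨q, hq, q0, q1, qa⟩ := core h s
  have e : ∀ r ∈ Ioo (0 : ℝ) R, r * deriv (fun s => g₂ s / g₁ s) r / (g₂ r / g₁ r) = q r := by
    intro r hr
    have n1 := (s.p1 r hr).ne'
    have n2 := (s.p2 r hr).ne'
    have d : deriv (fun s => g₂ s / g₁ s) r = (g₂' r * g₁ r - g₂ r * g₁' r) / g₁ r ^ 2 :=
      ((s.d2 r hr.1).div (s.d1 r hr.1) n1).deriv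
    rw [d, hq]
    field_simp
  intro r hr
  rw [e r hr]
  refine ⟨q0 r hr, q1 r hr, ?_⟩
  have a : AntitoneOn (fun s => s * deriv (fun t => g₂ t / g₁ t) s / (g₂ s / g₁ s)) (Ioo 0 R) :=
    qa.congr fun r hr => (e r hr).symm
  rw [← derivWithin_of_isOpen isOpen_Ioo hr]
  exact a.derivWithin_nonpos

lemma main (k n : ℕ) (hk : k = 2 ∨ k = 4 ∨ k = 8) (hn : 2 ≤ n) (hk8 : k = 8 → n = 2)
    (H : ℝ → ℝ)
    (hH : ∀ r : ℝ, 0 < r →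
      H r = ((k : ℝ) * n - 1) * (Real.cosh r / Real.sinh r) + ((k : ℝ) - 1) * Real.tanh r)
    (R lam1 : ℝ) (hR : 0 < R)
    (g₁ g₁' g₁'' : ℝ → ℝ)
    (hg₁d : ∀ r : ℝ, 0 < r → HasDerivAt g₁ (g₁' r) r)
    (hg₁d' : ∀ r : ℝ, 0 < r → HasDerivAt g₁' (g₁'' r) r)
    (hg₁ode : ∀ r : ℝ, 0 < r → g₁'' r + H r * g₁' r + lam1 * g₁ r = 0)
    (hg₁pos : ∀ r ∈ Set.Ioo (0 : ℝ) R, 0 < g₁ r)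
    (hg₁R : g₁ R = 0)
    (hg₁lim : Filter.Tendsto g₁ (nhdsWithin 0 (Set.Ioi 0)) (nhds 1))
    (hg₁'lim : Filter.Tendsto g₁' (nhdsWithin 0 (Set.Ioi 0)) (nhds 0))
    (Λ : ℝ → ℝ)
    (hΛ : ∀ r : ℝ, 0 < r →
      Λ r = ((k : ℝ) * n - 1) / Real.sinh r ^ 2 - ((k : ℝ) - 1) / Real.cosh r ^ 2)
    (lam2 : ℝ)
    (g₂ g₂' g₂'' : ℝ → ℝ)
    (hg₂d : ∀ r : ℝ, 0 < r → HasDerivAt g₂ (g₂' r) r)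
    (hg₂d' : ∀ r : ℝ, 0 < r → HasDerivAt g₂' (g₂'' r) r)
    (hg₂ode : ∀ r : ℝ, 0 < r → g₂'' r + H r * g₂' r + (lam2 - Λ r) * g₂ r = 0)
    (hg₂pos : ∀ r ∈ Set.Ioo (0 : ℝ) R, 0 < g₂ r)
    (hg₂R : g₂ R = 0)
    (hg₂lim : Filter.Tendsto (fun r => g₂ r / r) (nhdsWithin 0 (Set.Ioi 0)) (nhds 1))
    (hg₂'lim : Filter.Tendsto g₂' (nhdsWithin 0 (Set.Ioi 0)) (nhds 1)) :
    ∀ r ∈ Set.Ioo (0 : ℝ) R,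
      0 ≤ r * deriv (fun s => g₂ s / g₁ s) r / (g₂ r / g₁ r) ∧
      r * deriv (fun s => g₂ s / g₁ s) r / (g₂ r / g₁ r) ≤ 1 ∧
      deriv (fun s => s * deriv (fun t => g₂ t / g₁ t) s / (g₂ s / g₁ s)) r ≤ 0 := by
  have hnR : (2:ℝ) ≤ n := by exact_mod_cast hn
  have hk2 : (2:ℝ) ≤ k := by rcases hk with h | h | h <;> subst h <;> norm_num
  set a : ℝ := (k : ℝ) * n - 1 with ha
  set b : ℝ := (k : ℝ) - 1 with hb
  have he : 0 < a - b := by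
    have : a - b = k * (n - 1) := by rw [ha, hb]; ring
    rw [this]; exact mul_pos (by linarith) (by linarith)
  have hg1 : 1 ≤ (a + b) / (a - b) := by
    rw [le_div_iff₀ he]; linarith
  have hg2 : (a + b) / (a - b) ≤ 11 / 4 := by
    rw [div_le_iff₀ he]
    rcases hk with h | h | h
    · subst h; push_cast at ha hb; linarith
    · subst h; push_cast at ha hb; linarith
    · have := hk8 h
      subst h; subst this; push_cast at ha hb; linarith
  have kn1 : 1 ≤ k * n := by
    have : 2 ≤ k := by exact_mod_cast hk2
    nlinarith
  have cA : ((k * n - 1 : ℕ) : ℝ) = a := by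
    rw [Nat.cast_sub kn1]; push_cast; rfl
  have cB : ((k - 1 : ℕ) : ℝ) = b := by
    have : 1 ≤ k := by rcases hk with h | h | h <;> subst h <;> norm_num
    rw [Nat.cast_sub this]; push_cast; rfl
  have A0 : k * n - 1 ≠ 0 := by
    have : 2 ≤ k := by exact_mod_cast hk2
    have : 4 ≤ k * n := by nlinarith
    omega
  have eH : ∀ r, 0 < r → (a - b) * hh ((a + b) / (a - b)) (2 * r) = H r := by
    intro r hr; rw [hH r hr, H_id a b he.ne' hr]
  have eL : ∀ r, 0 < r → 2 * (a - b) * ll ((a + b) / (a - b)) (2 * r) = Λ r := by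
    intro r hr; rw [hΛ r hr, L_id a b he.ne' hr]
  refine final (w := fun r => sinh r ^ (k * n - 1) * cosh r ^ (k - 1)) (lam1 := lam1) (lam2 := lam2) (g₁' := g₁') (g₂' := g₂')
    (mkPot hg1 hg2 he) ?_
  refine ⟨hR, ?_, ?_, w_zero A0 _, hg₁d, ?_, hg₂d, ?_, hg₁pos, hg₂pos, hg₁R, hg₂R, hg₁lim, hg₁'lim,
    hg₂lim, hg₂'lim⟩
  · intro r hr
    have := w_der (k * n - 1) (k - 1) hr
    rw [cA, cB, H_id a b he.ne' hr] at this
    exact this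
  · intro r hr
    exact mul_pos (pow_pos (s_pos hr) _) (pow_pos (cosh_pos r) _)
  · intro r hr
    refine (hg₁d' r hr).congr_deriv ?_
    simp only [eH r hr]
    linarith [hg₁ode r hr]
  · intro r hr
    refine (hg₂d' r hr).congr_deriv ?_
    simp only [eH r hr, eL r hr]
    linarith [hg₂ode r hr]


end Aux9

/-- The function q(r) = r·G′(r)/G(r), with G = g₂/g₁, satisfies
0 ≤ q(r) ≤ 1 and q′(r) ≤ 0 for every r ∈ (0,R). -/
theorem stmt_9
    (k n : ℕ) (hk : k = 2 ∨ k = 4 ∨ k = 8) (hn : 2 ≤ n) (hk8 : k = 8 → n = 2)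
    (H : ℝ → ℝ)
    (hH : ∀ r : ℝ, 0 < r →
      H r = ((k : ℝ) * n - 1) * (Real.cosh r / Real.sinh r) + ((k : ℝ) - 1) * Real.tanh r)
    (R lam1 : ℝ) (hR : 0 < R) (hlam1 : 0 < lam1)
    (g₁ g₁' g₁'' : ℝ → ℝ)
    (hg₁d : ∀ r : ℝ, 0 < r → HasDerivAt g₁ (g₁' r) r)
    (hg₁d' : ∀ r : ℝ, 0 < r → HasDerivAt g₁' (g₁'' r) r)
    (hg₁c : ContinuousOn g₁'' (Set.Ioi 0))
    (hg₁ode : ∀ r : ℝ, 0 < r → g₁'' r + H r * g₁' r + lam1 * g₁ r = 0)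
    (hg₁pos : ∀ r ∈ Set.Ioo (0 : ℝ) R, 0 < g₁ r)
    (hg₁R : g₁ R = 0)
    (hg₁lim : Filter.Tendsto g₁ (nhdsWithin 0 (Set.Ioi 0)) (nhds 1))
    (hg₁'lim : Filter.Tendsto g₁' (nhdsWithin 0 (Set.Ioi 0)) (nhds 0))
    (Λ : ℝ → ℝ)
    (hΛ : ∀ r : ℝ, 0 < r →
      Λ r = ((k : ℝ) * n - 1) / Real.sinh r ^ 2 - ((k : ℝ) - 1) / Real.cosh r ^ 2)
    (lam2 : ℝ)
    (g₂ g₂' g₂'' : ℝ → ℝ)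
    (hg₂d : ∀ r : ℝ, 0 < r → HasDerivAt g₂ (g₂' r) r)
    (hg₂d' : ∀ r : ℝ, 0 < r → HasDerivAt g₂' (g₂'' r) r)
    (hg₂c : ContinuousOn g₂'' (Set.Ioi 0))
    (hg₂ode : ∀ r : ℝ, 0 < r → g₂'' r + H r * g₂' r + (lam2 - Λ r) * g₂ r = 0)
    (hg₂pos : ∀ r ∈ Set.Ioo (0 : ℝ) R, 0 < g₂ r)
    (hg₂R : g₂ R = 0)
    (hg₂lim : Filter.Tendsto (fun r => g₂ r / r) (nhdsWithin 0 (Set.Ioi 0)) (nhds 1))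
    (hg₂'lim : Filter.Tendsto g₂' (nhdsWithin 0 (Set.Ioi 0)) (nhds 1))
    (hubar1 : ∃ v : ℝ → ℝ, ContDiffOn ℝ 1 v (Set.Icc 0 R) ∧
      (∀ r ∈ Set.Ioo (0 : ℝ) R,
        v r = Real.sinh r ^ (((k : ℝ) * n - 1) / 2) * Real.cosh r ^ (((k : ℝ) - 1) / 2) * g₁ r) ∧
      v 0 = 0 ∧ v R = 0)
    (hubar2 : ∃ v : ℝ → ℝ, ContDiffOn ℝ 1 v (Set.Icc 0 R) ∧
      (∀ r ∈ Set.Ioo (0 : ℝ) R,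
        v r = Real.sinh r ^ (((k : ℝ) * n - 1) / 2) * Real.cosh r ^ (((k : ℝ) - 1) / 2) * g₂ r) ∧
      v 0 = 0 ∧ v R = 0) :
    ∀ r ∈ Set.Ioo (0 : ℝ) R,
      0 ≤ r * deriv (fun s => g₂ s / g₁ s) r / (g₂ r / g₁ r) ∧
      r * deriv (fun s => g₂ s / g₁ s) r / (g₂ r / g₁ r) ≤ 1 ∧
      deriv (fun s => s * deriv (fun t => g₂ t / g₁ t) s / (g₂ s / g₁ s)) r ≤ 0 := by
  exact Aux9.main k n hk hn hk8 H hH R lam1 hR g₁ g₁' g₁'' hg₁d hg₁d' hg₁ode hg₁pos hg₁R hg₁lim hg₁'lim Λ hΛ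
    lam2 g₂ g₂' g₂'' hg₂d hg₂d' hg₂ode hg₂pos hg₂R hg₂lim hg₂'lim
end
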